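/- arXiv:1604.02317 — 2 statements merged into one kernel-verified Lean document; each statement's English description precedes it below -/
import Mathlib

section
/- Let k,c≥1, let (G,s_1,t_1,…,s_k,t_k) be a problem instance where G has a clique-partition (C_1,…,C_c), let L=(P_1,…,P_k) be a minimum linkage for it, let (v_1,…,v_n) be an enumeration of V(L)∖{s_1,…,s_k,t_1,…,t_k}, and let B_h, A_h, 𝒜_h, ℬ_h (0≤h≤n) be as defined, with s=k²+k+3. Let w≥0, let 0≤h≤n, and suppose that B_h∩C_a is C_a-acceptable for L for every a∈{1,…,c}, and that the (A_h,B_h)-wiggle number of each member of L is at most w. Then |ℬ_h⁺∩𝒜_h⁻| ≤ 2cskw+c(2w+1)k²(k²+k+1). -/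
open scoped Classical

noncomputable section

/-- A digraph: loopless, no parallel edges (an adjacency relation);
for distinct `u v` both `adj u v` and `adj v u` may hold. -/
structure Dgraph (V : Type) where
  adj : V → V → Prop
  irrefl : ∀ v, ¬ adj v v

/-- A directed path in a digraph `G`, given by its (nonempty, duplicate-free) list of
vertices, consecutive vertices being adjacent. -/
structure Dpath {V : Type} (G : Dgraph V) where
  verts : List V
  ne : verts ≠ []
  nodup : verts.Nodup
  chain : verts.Chain' G.adj

namespace Dpath

variable {V : Type} {G : Dgraph V}

/-- `s(P)`, the first vertex of a path. -/
def first (P : Dpath G) : V := P.verts.head P.ne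

/-- `t(P)`, the last vertex of a path. -/
def last (P : Dpath G) : V := P.verts.getLast P.ne

/-- `V(P)`, the set of vertices of a path. -/
def support (P : Dpath G) : Set V := {v | v ∈ P.verts}

/-- The length of a path: its number of edges. -/
def length (P : Dpath G) : ℕ := P.verts.length - 1

/-- `Q` is a subpath of `P`. -/
def IsSubpath (Q P : Dpath G) : Prop := Q.verts <:+: P.verts

/-- `Q` is an initial subpath of `P` (a subpath with `s(Q) = s(P)`). -/
def IsInitialSubpath (Q P : Dpath G) : Prop := Q.verts <+: P.verts

/-- The (directed) edges of a path, as ordered pairs of consecutive vertices. -/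
def edges (P : Dpath G) : List (V × V) := P.verts.zip P.verts.tail

end Dpath

variable {V : Type}

/-- A family of paths is a linkage when its members are pairwise vertex-disjoint. -/
def IsLinkage {G : Dgraph V} {k : ℕ} (L : Fin k → Dpath G) : Prop :=
  ∀ i j, i ≠ j → Disjoint (L i).support (L j).support

/-- `V(L)`, the union of the vertex sets of the members of a linkage. -/
def linkSupport {G : Dgraph V} {k : ℕ} (L : Fin k → Dpath G) : Set V :=
  ⋃ i, (L i).support

/-- `(G, s 1, t 1, …, s k, t k)` is a problem instance: the `2k` vertices are distinct. -/
def IsInstance {k : ℕ} (sv tv : Fin k → V) : Prop :=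
  Function.Injective sv ∧ Function.Injective tv ∧ ∀ i j, sv i ≠ tv j

/-- `L` is a linkage for the problem instance: its `i`-th member runs from `s i` to `t i`. -/
def IsLinkageFor {G : Dgraph V} {k : ℕ} (L : Fin k → Dpath G) (sv tv : Fin k → V) : Prop :=
  IsLinkage L ∧ ∀ i, (L i).first = sv i ∧ (L i).last = tv i

/-- A linkage is minimum if no linkage joining the same pairs of ends uses fewer vertices. -/
def IsMinimumLinkage {G : Dgraph V} {k : ℕ} (L : Fin k → Dpath G) : Prop :=
  IsLinkage L ∧ ∀ L' : Fin k → Dpath G, IsLinkage L' →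
    (∀ i, (L' i).first = (L i).first ∧ (L' i).last = (L i).last) →
    (linkSupport L).ncard ≤ (linkSupport L').ncard

/-- A minimum linkage for a problem instance. -/
def IsMinimumLinkageFor {G : Dgraph V} {k : ℕ} (L : Fin k → Dpath G)
    (sv tv : Fin k → V) : Prop :=
  IsLinkageFor L sv tv ∧ IsMinimumLinkage L

/-- `C ⊆ V(G)` is a clique if `G[C]` is semicomplete. -/
def Dgraph.IsClique (G : Dgraph V) (C : Set V) : Prop :=
  ∀ u ∈ C, ∀ v ∈ C, u ≠ v → (G.adj u v ∨ G.adj v u)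

/-- `(C 1, …, C c)` is a clique-partition of `G`: a partition of `V(G)` into
(possibly empty) cliques. -/
def Dgraph.IsCliquePartition (G : Dgraph V) {c : ℕ} (C : Fin c → Set V) : Prop :=
  (∀ a, G.IsClique (C a)) ∧ ∀ v : V, ∃! a, v ∈ C a

/-- The internal vertices of a linkage: vertices of `V(L)` not an end of any member. -/
def internalVerts {G : Dgraph V} {k : ℕ} (L : Fin k → Dpath G) : Set V :=
  linkSupport L \ ((Set.range fun i => (L i).first) ∪ (Set.range fun i => (L i).last))

/-- `M` is internally disjoint from `L`: no internal vertex of `M` belongs to `V(L)`. -/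
def InternallyDisjointFrom {G : Dgraph V} {m k : ℕ} (M : Fin m → Dpath G)
    (L : Fin k → Dpath G) : Prop :=
  ∀ v ∈ internalVerts M, v ∉ linkSupport L

/-- A planar `(Q,R)`-matching of cardinality `n`: a linkage of `n` paths, each with at most
three vertices, whose first vertices lie on `Q` in order and last vertices lie on `R` in
order. -/
def IsPlanarMatching {G : Dgraph V} {n : ℕ} (Q R : Dpath G) (M : Fin n → Dpath G) : Prop :=
  IsLinkage M ∧ (∀ j, (M j).verts.length ≤ 3) ∧
  (List.ofFn fun j => (M j).first).Sublist Q.verts ∧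
  (List.ofFn fun j => (M j).last).Sublist R.verts

/-- A planar `(Q,R)`-matching from `X` to `Y`. -/
def IsPlanarMatchingFromTo {G : Dgraph V} {n : ℕ} (Q R : Dpath G) (M : Fin n → Dpath G)
    (X Y : Set V) : Prop :=
  IsPlanarMatching Q R M ∧ ∀ j, (M j).first ∈ X ∧ (M j).last ∈ Y

/-- `B ⊆ C` is `C`-acceptable for the linkage `L` (for the instance given by `sv, tv`). -/
def CAcceptable {G : Dgraph V} {k : ℕ} (sv tv : Fin k → V) (L : Fin k → Dpath G)
    (C B : Set V) : Prop :=
  B ⊆ C ∧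
  Set.range sv ∩ C ⊆ B ∧
  Set.range tv ∩ B = ∅ ∧
  (∀ i, ∃ Q : Dpath G, Q.IsInitialSubpath (L i) ∧ Q.support ∩ C = (L i).support ∩ B) ∧
  ∀ i j : Fin k, ¬ ∃ M : Fin (k ^ 2 + k + 2) → Dpath G,
      IsPlanarMatchingFromTo (L i) (L j) M B (C \ B) ∧ InternallyDisjointFrom M L

/-- A list of vertices is `(X,Y)`-alternating: entries with even position (0-based) are
in `X`, those with odd position in `Y`. -/
def Alternating (X Y : Set V) (l : List V) : Prop :=
  ∀ (i : ℕ) (h : i < l.length),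
    if i % 2 = 0 then l.get ⟨i, h⟩ ∈ X else l.get ⟨i, h⟩ ∈ Y

/-- `P` contains an `(X,Y)`-alternating sequence (of distinct vertices, in order in `P`)
of length `2 * m`. -/
def HasAlt {G : Dgraph V} (P : Dpath G) (X Y : Set V) (m : ℕ) : Prop :=
  ∃ l : List V, l.Sublist P.verts ∧ l.length = 2 * m ∧ Alternating X Y l

/-- The `(X,Y)`-wiggle number of `P`: half the length of the longest `(X,Y)`-alternating
sequence of vertices in order in `P`. -/
def wiggle {G : Dgraph V} (P : Dpath G) (X Y : Set V) : ℕ :=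
  sSup {m | HasAlt P X Y m}

/-- `zOf k c = c(c(k²+k+1)+k+2)`. -/
def zOf (k c : ℕ) : ℕ := c * (c * (k ^ 2 + k + 1) + k + 2)

/-- `wOf k c = c(c−1)(z+1)+1`. -/
def wOf (k c : ℕ) : ℕ := c * (c - 1) * (zOf k c + 1) + 1

/-- `rOf k c = ckw`. -/
def rOf (k c : ℕ) : ℕ := c * k * wOf k c

/-- `sOf k = k²+k+3`. -/
def sOf (k : ℕ) : ℕ := k ^ 2 + k + 3

/-- `tOf k c = 2cskw + c(2w+1)k²(k²+k+1)`. -/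
def tOf (k c : ℕ) : ℕ :=
  2 * c * sOf k * k * wOf k c + c * (2 * wOf k c + 1) * k ^ 2 * (k ^ 2 + k + 1)

/-- Given a clique-partition `C` and a linkage `L` for the instance, `B` is acceptable
(with `A = V(G) ∖ B`). -/
def Acceptable {G : Dgraph V} {k c : ℕ} (sv tv : Fin k → V) (L : Fin k → Dpath G)
    (C : Fin c → Set V) (z : ℕ) (B : Set V) : Prop :=
  (∀ i, sv i ∈ B) ∧ (∀ i, tv i ∉ B) ∧
  (∀ a, CAcceptable sv tv L (C a) (B ∩ C a)) ∧
  ∀ a b, a ≠ b → ∀ i, wiggle (L i) (B ∩ C b) (Bᶜ ∩ C a) ≤ z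

/-- The vertices of `l` belonging to `C`, in order. -/
def inOrderIn (l : List V) (C : Set V) : List V := l.filter fun v => decide (v ∈ C)

/-- The last `m` (or "up to `m`") vertices of the path `P` in `C`, in order along `P`. -/
def lastIn {G : Dgraph V} (P : Dpath G) (C : Set V) (m : ℕ) : List V :=
  (inOrderIn P.verts C).drop ((inOrderIn P.verts C).length - m)

/-- The first up-to-`m` vertices of the path `P` in `C`, in order along `P`. -/
def firstUpTo {G : Dgraph V} (P : Dpath G) (C : Set V) (m : ℕ) : List V :=
  (inOrderIn P.verts C).take m

/-- The set of terms of a vertex sequence. -/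
def seqSet (X : List V) : Set V := {v | v ∈ X}

/-- `𝒜⁺` for a set `𝒜` of vertex sequences. -/
def plusSet (G : Dgraph V) {c : ℕ} (C : Fin c → Set V) (s : ℕ) (𝒜 : Set (List V)) : Set V :=
  {v | ∃ X ∈ 𝒜, ∃ a, insert v (seqSet X) ⊆ C a ∧
    (v ∈ X ∨ (v ∉ X ∧ X.length = s ∧ ∀ u ∈ X.drop (X.length - (s - 1)), G.adj u v))}

/-- `𝒜⁻` for a set `𝒜` of vertex sequences. -/
def minusSet (G : Dgraph V) {c : ℕ} (C : Fin c → Set V) (s : ℕ) (𝒜 : Set (List V)) : Set V :=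
  {v | ∃ X ∈ 𝒜, ∃ a, insert v (seqSet X) ⊆ C a ∧
    (v ∈ X ∨ (v ∉ X ∧ X.length = s ∧ ∀ u ∈ X.take (s - 1), G.adj v u))}

/-- A set `D ⊆ V(G)` is `(r,s,t)`-restricted. -/
def Restricted (G : Dgraph V) {c : ℕ} (C : Fin c → Set V) (r s t : ℕ) (D : Set V) : Prop :=
  ∃ 𝒜 ℬ : Set (List V),
    (∀ X ∈ 𝒜, X.length ≤ s) ∧ (∀ X ∈ ℬ, X.length ≤ s) ∧
    𝒜.ncard ≤ r ∧ ℬ.ncard ≤ r ∧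
    (plusSet G C s ℬ ∩ minusSet G C s 𝒜).ncard ≤ t ∧
    plusSet G C s ℬ \ minusSet G C s 𝒜 ⊆ D ∧
    D ⊆ plusSet G C s ℬ

/-- `e` is an enumeration of `V(L) ∖ {s 1,…,s k,t 1,…,t k}`. -/
def IsEnumeration {G : Dgraph V} {k : ℕ} (L : Fin k → Dpath G) (sv tv : Fin k → V)
    (e : List V) : Prop :=
  e.Nodup ∧ {v | v ∈ e} = linkSupport L \ (Set.range sv ∪ Set.range tv)

/-- `B h = {s 1,…,s k} ∪ {v 1,…,v h}`, for the enumeration `e`. -/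
def BsetOf {k : ℕ} (sv : Fin k → V) (e : List V) (h : ℕ) : Set V :=
  Set.range sv ∪ {v | v ∈ e.take h}

/-- `A h = V(L) ∖ B h`. -/
def AsetOf {G : Dgraph V} {k : ℕ} (L : Fin k → Dpath G) (sv : Fin k → V) (e : List V)
    (h : ℕ) : Set V :=
  linkSupport L \ BsetOf sv e h

/-- The maximal subpaths of members of `L` with all vertices in `S`: the components,
included in `S`, of the digraph obtained from `P 1 ∪ ⋯ ∪ P k` by deleting the edges with
exactly one end in `S`. -/
def segsIn {G : Dgraph V} {k : ℕ} (L : Fin k → Dpath G) (S : Set V) : Set (Dpath G) :=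
  {Q | ∃ i, Q.IsSubpath (L i) ∧ Q.support ⊆ S ∧
    ∀ Q' : Dpath G, Q'.IsSubpath (L i) → Q'.support ⊆ S → Q.IsSubpath Q' →
      Q'.verts = Q.verts}

/-- `𝒜 h`: first up-to-`s` vertices in each `C a` of each path of `ℛ h`. -/
def AseqsOf (G : Dgraph V) {k c : ℕ} (C : Fin c → Set V) (s : ℕ) (L : Fin k → Dpath G)
    (sv : Fin k → V) (e : List V) (h : ℕ) : Set (List V) :=
  {X | ∃ R ∈ segsIn L (AsetOf L sv e h), ∃ a, X = firstUpTo R (C a) s}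

/-- `ℬ h`: last up-to-`s` vertices in each `C a` of each path of `𝒬 h`. -/
def BseqsOf (G : Dgraph V) {k c : ℕ} (C : Fin c → Set V) (s : ℕ) (L : Fin k → Dpath G)
    (sv : Fin k → V) (e : List V) (h : ℕ) : Set (List V) :=
  {X | ∃ Q ∈ segsIn L (BsetOf sv e h), ∃ a, X = lastIn Q (C a) s}

/-- `D h = (ℬ h⁺ ∖ 𝒜 h⁻) ∪ B h`. -/
def DsetOf (G : Dgraph V) {k c : ℕ} (C : Fin c → Set V) (s : ℕ) (L : Fin k → Dpath G)
    (sv : Fin k → V) (e : List V) (h : ℕ) : Set V :=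
  (plusSet G C s (BseqsOf G C s L sv e h) \ minusSet G C s (AseqsOf G C s L sv e h))
    ∪ BsetOf sv e h

/-- The edges of the members of a linkage. -/
def linkEdges {G : Dgraph V} {k : ℕ} (L : Fin k → Dpath G) : Set (V × V) :=
  ⋃ i, {p | p ∈ (L i).edges}

/-- `J h`: the edges of `P 1 ∪ ⋯ ∪ P k` with one end in `A h` and the other in `B h`. -/
def JsetOf {G : Dgraph V} {k : ℕ} (L : Fin k → Dpath G) (sv : Fin k → V) (e : List V)
    (h : ℕ) : Set (V × V) :=
  {p ∈ linkEdges L |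
    (p.1 ∈ AsetOf L sv e h ∧ p.2 ∈ BsetOf sv e h) ∨
    (p.1 ∈ BsetOf sv e h ∧ p.2 ∈ AsetOf L sv e h)}

/-- `Y h = {(e,i) : e ∈ J h ∩ E(P i)}`, as a set of coloured edges. -/
def YsetOf {G : Dgraph V} {k : ℕ} (L : Fin k → Dpath G) (sv : Fin k → V) (e : List V)
    (h : ℕ) : Set ((V × V) × Fin k) :=
  {p | p.1 ∈ JsetOf L sv e h ∧ p.1 ∈ (L p.2).edges}

/-- `ℰ`: the admissible sets of coloured edges (a coloured edge is a pair `(e,i)` with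
`e ∈ E(G)` and `i` a colour in `Fin k`; its tail is `e.1` and its head is `e.2`). -/
def EdgeSets (G : Dgraph V) {k : ℕ} (sv tv : Fin k → V) (w : ℕ) :
    Set (Set ((V × V) × Fin k)) :=
  {Y | (∀ p ∈ Y, G.adj p.1.1 p.1.2) ∧
    Y.ncard ≤ 2 * w - 1 ∧
    (∀ p ∈ Y, ∀ q ∈ Y, p ≠ q → p.1.2 ≠ q.1.2 ∧ p.1.1 ≠ q.1.1) ∧
    (∀ p ∈ Y, ∀ q ∈ Y, ({p.1.1, p.1.2} ∩ {q.1.1, q.1.2} : Set V).Nonempty → p.2 = q.2) ∧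
    (∀ p ∈ Y, p.1.2 ∉ Set.range sv ∧ p.1.1 ∉ Set.range tv) ∧
    (∀ p ∈ Y, ∀ i, (p.1.1 = sv i → p.2 = i) ∧ (p.1.2 = tv i → p.2 = i))}

/-- The vertices of the auxiliary digraph `H`: pairs `(Y,D)` with `Y ∈ ℰ`, `D ∈ 𝒟`
(i.e. `D` is `(r,s,t)`-restricted), such that every coloured edge of `Y` has exactly one
end in `D`. -/
def HVert (G : Dgraph V) {k c : ℕ} (sv tv : Fin k → V) (C : Fin c → Set V)
    (w r s t : ℕ) (x : Set ((V × V) × Fin k) × Set V) : Prop :=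
  x.1 ∈ EdgeSets G sv tv w ∧ Restricted G C r s t x.2 ∧
  ∀ p ∈ x.1, Xor' (p.1.1 ∈ x.2) (p.1.2 ∈ x.2)

/-- Adjacency in the auxiliary digraph `H`. -/
def HAdj (G : Dgraph V) {k c : ℕ} (sv tv : Fin k → V) (C : Fin c → Set V)
    (w r s t : ℕ) (x y : Set ((V × V) × Fin k) × Set V) : Prop :=
  x ≠ y ∧ HVert G sv tv C w r s t x ∧ HVert G sv tv C w r s t y ∧ x.2 ⊆ y.2 ∧
  ∃ p q : (V × V) × Fin k, p ≠ q ∧ symmDiff x.1 y.1 = {p, q} ∧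
    p.1.2 = q.1.1 ∧ p.1.1 ≠ q.1.2 ∧ p.1.2 ∈ y.2 \ x.2

/-- The auxiliary digraph `H`. -/
def auxH (G : Dgraph V) {k c : ℕ} (sv tv : Fin k → V) (C : Fin c → Set V)
    (w r s t : ℕ) : Dgraph (Set ((V × V) × Fin k) × Set V) :=
  ⟨HAdj G sv tv C w r s t, fun _ hx => hx.1 rfl⟩

/-- `S 0`: the vertices `(Y,D)` of `H` with `|Y| = k` and every member of `Y` having tail
in `{s 1,…,s k}`. -/
def S0set (G : Dgraph V) {k c : ℕ} (sv tv : Fin k → V) (C : Fin c → Set V)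
    (w r s t : ℕ) : Set (Set ((V × V) × Fin k) × Set V) :=
  {x | HVert G sv tv C w r s t x ∧ x.1.ncard = k ∧ ∀ p ∈ x.1, p.1.1 ∈ Set.range sv}

/-- `T 0`: the vertices `(Y,D)` of `H` with `|Y| = k` and every member of `Y` having head
in `{t 1,…,t k}`. -/
def T0set (G : Dgraph V) {k c : ℕ} (sv tv : Fin k → V) (C : Fin c → Set V)
    (w r s t : ℕ) : Set (Set ((V × V) × Fin k) × Set V) :=
  {x | HVert G sv tv C w r s t x ∧ x.1.ncard = k ∧ ∀ p ∈ x.1, p.1.2 ∈ Set.range tv}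

end

namespace PIM

open Finset

theorem card_linkSupport {V : Type} {G : Dgraph V} {k : ℕ} (L : Fin k → Dpath G)
    (hL : IsLinkage L) : (linkSupport L).ncard = ∑ i, (L i).verts.length := by
  have h1 : linkSupport L = ↑(Finset.univ.biUnion fun i => (L i).verts.toFinset) := by
    ext v; simp [linkSupport, Dpath.support]
  rw [h1, Set.ncard_coe_finset, Finset.card_biUnion]
  · exact Finset.sum_congr rfl fun i _ => List.toFinset_card_of_nodup (L i).nodup
  · intro i _ j _ hij
    have := hL i j hij
    rw [Function.onFun, Finset.disjoint_left]
    intro v hv hv'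
    exact Set.disjoint_left.1 this (by simpa [Dpath.support] using hv)
      (by simpa [Dpath.support] using hv')

theorem core {V : Type} {G : Dgraph V} {k : ℕ} (L : Fin k → Dpath G)
    (hL : IsMinimumLinkage L) (N : Fin k → List V) (hnd : ∀ i, (N i).Nodup)
    (hch : ∀ i, (N i).IsChain G.adj) (hh : ∀ i, (N i).head? = (L i).verts.head?)
    (hl : ∀ i, (N i).getLast? = (L i).verts.getLast?)
    (hdis : ∀ i j, i ≠ j → ∀ u ∈ N i, u ∉ N j) :
    ∑ i, (L i).verts.length ≤ ∑ i, (N i).length := by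
  have hne : ∀ i, N i ≠ [] := by
    intro i h
    have := hh i
    rw [h] at this
    have h2 := (L i).ne
    cases h3 : (L i).verts <;> simp_all
  let L' : Fin k → Dpath G := fun i => ⟨N i, hne i, hnd i, hch i⟩
  have hL' : IsLinkage L' := by
    intro i j hij
    rw [Set.disjoint_left]
    intro v hv hv'
    exact hdis i j hij v hv hv'
  have := hL.2 L' hL' (by
    intro i
    constructor
    · have := hh i
      rw [List.head?_eq_some_head (hne i), List.head?_eq_some_head (L i).ne] at this
      exact Option.some.inj this
    · have := hl i
      rw [List.getLast?_eq_some_getLast (hne i), List.getLast?_eq_some_getLast (L i).ne] at this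
      exact Option.some.inj this)
  rw [card_linkSupport L hL.1, card_linkSupport L' hL'] at this
  exact this

theorem mem_uniq {V : Type} {G : Dgraph V} {k : ℕ} {L : Fin k → Dpath G}
    (hL : IsLinkage L) {i j : Fin k} {u : V} (hi : u ∈ (L i).verts) (hj : u ∈ (L j).verts) :
    i = j := by
  by_contra h
  exact Set.disjoint_left.1 (hL i j h) hi hj

theorem single {V : Type} {G : Dgraph V} {k : ℕ} (L : Fin k → Dpath G)
    (hL : IsMinimumLinkage L) (i : Fin k) (p m q n : List V) (hp : p ≠ []) (hq : q ≠ [])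
    (hP : (L i).verts = p ++ m ++ q) (hc : (p ++ n ++ q).IsChain G.adj) (hnd : n.Nodup)
    (hn : ∀ u ∈ n, u ∉ linkSupport L) : m.length ≤ n.length := by
  have hPnd := (L i).nodup
  have hsup : ∀ l, ∀ u ∈ (L l).verts, u ∈ linkSupport L := fun l u hu =>
    Set.mem_iUnion.2 ⟨l, hu⟩
  have key := core L hL (Function.update (fun l => (L l).verts) i (p ++ n ++ q)) ?_ ?_ ?_ ?_ ?_
  · rw [← Finset.add_sum_erase _ _ (Finset.mem_univ i),
      ← Finset.add_sum_erase (a := i) _ (fun l => (Function.update (fun l => (L l).verts) i (p ++ n ++ q) l).length) (Finset.mem_univ i)] at key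
    have : ∑ x ∈ Finset.univ.erase i, (Function.update (fun l => (L l).verts) i (p ++ n ++ q) x).length
        = ∑ x ∈ Finset.univ.erase i, (L x).verts.length := by
      refine Finset.sum_congr rfl fun x hx => ?_
      rw [Function.update_of_ne (Finset.ne_of_mem_erase hx)]
    rw [this] at key
    simp [hP] at key
    omega
  · intro l
    by_cases h : l = i
    · subst h
      have : ∀ u ∈ n, u ∉ p ∧ u ∉ q := by
        intro u hu
        have := hn u hu
        constructor <;> intro h' <;> exact this (hsup l u (by rw [hP]; simp [h']))
      rw [hP] at hPnd
      simp only [Function.update_self]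
      simp only [List.nodup_append, List.mem_append] at hPnd ⊢
      grind
    · rw [Function.update_of_ne h]; exact (L l).nodup
  · intro l
    by_cases h : l = i
    · subst h; simpa using hc
    · rw [Function.update_of_ne h]; exact (L l).chain
  · intro l
    by_cases h : l = i
    · subst h; simp [hP, List.head?_append, List.head?_eq_some_head hp]
    · rw [Function.update_of_ne h]
  · intro l
    by_cases h : l = i
    · subst h; simp [hP, List.getLast?_append, List.getLast?_eq_some_getLast hq]
    · rw [Function.update_of_ne h]
  · intro l l' hll u hu hu'
    have hi : ∀ u ∈ p ++ n ++ q, u ∈ (L i).verts ∨ u ∉ linkSupport L := by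
      intro u hu
      rw [hP]
      have := hn u
      simp only [List.mem_append] at hu ⊢
      tauto
    have h3 := @mem_uniq _ _ _ L hL.1
    by_cases h : l = i
    · subst h
      rw [Function.update_self] at hu
      rw [Function.update_of_ne (Ne.symm hll)] at hu'
      rcases hi u hu with h | h
      · exact hll (h3 h hu')
      · exact h (hsup _ _ hu')
    · rw [Function.update_of_ne h] at hu
      by_cases h2 : l' = i
      · subst h2
        rw [Function.update_self] at hu'
        rcases hi u hu' with h | h
        · exact hll (h3 hu h)
        · exact h (hsup _ _ hu)
      · rw [Function.update_of_ne h2] at hu'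
        exact hll (h3 hu hu')

theorem double {V : Type} {G : Dgraph V} {k : ℕ} (L : Fin k → Dpath G)
    (hL : IsMinimumLinkage L) (i j : Fin k) (hij : i ≠ j)
    (p m q n p' m' q' n' : List V) (hp : p ≠ []) (hq : q ≠ []) (hp' : p' ≠ []) (hq' : q' ≠ [])
    (hP : (L i).verts = p ++ m ++ q) (hP' : (L j).verts = p' ++ m' ++ q')
    (hc : (p ++ n ++ q).IsChain G.adj) (hc' : (p' ++ n' ++ q').IsChain G.adj)
    (hnd : (n ++ n').Nodup)
    (hn : ∀ u ∈ n ++ n', u ∉ linkSupport L ∨ u ∈ m ∨ u ∈ m') :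
    m.length + m'.length ≤ n.length + n'.length := by
  have hPnd := (L i).nodup
  have hPnd' := (L j).nodup
  have hsup : ∀ l, ∀ u ∈ (L l).verts, u ∈ linkSupport L := fun l u hu =>
    Set.mem_iUnion.2 ⟨l, hu⟩
  have h3 := @mem_uniq _ _ _ L hL.1
  have hmi : ∀ u, u ∈ (L i).verts ↔ u ∈ p ∨ u ∈ m ∨ u ∈ q := by
    intro u; rw [hP]; simp
  have hmj : ∀ u, u ∈ (L j).verts ↔ u ∈ p' ∨ u ∈ m' ∨ u ∈ q' := by
    intro u; rw [hP']; simp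
  have hnot : ∀ u, u ∈ (L i).verts → u ∈ (L j).verts → False := fun u a b => hij (h3 a b)
  rw [hP] at hPnd
  rw [hP'] at hPnd'
  simp only [List.nodup_append, List.mem_append] at hPnd hPnd' hnd hn
  have hout : ∀ l, l ≠ i → l ≠ j → ∀ u ∈ (L l).verts, u ∉ p ++ n ++ q ∧ u ∉ p' ++ n' ++ q' := by
    intro l hli hlj u hu
    have a1 : u ∉ (L i).verts := fun h => hli (h3 hu h)
    have a2 : u ∉ (L j).verts := fun h => hlj (h3 hu h)
    have a3 := hsup l u hu
    have a4 := hn u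
    rw [hmi] at a1
    rw [hmj] at a2
    simp only [List.mem_append]
    tauto
  have hsi := hsup i
  have hsj := hsup j
  have hnn : ∀ u ∈ p ++ n ++ q, u ∉ p' ++ n' ++ q' := by
    intro u hu hu'
    have a1 := hn u
    have a2 := hsi u
    have a3 := hsj u
    have a4 := hnot u
    rw [hmi] at a2 a4
    rw [hmj] at a3 a4
    simp only [List.mem_append] at hu hu'
    grind
  have N1 : (p ++ n ++ q).Nodup := by
    have : ∀ u ∈ n, u ∉ p ∧ u ∉ q := by
      intro u hu
      have a1 := hn u
      have a2 := hsi u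
      have a4 := hnot u
      rw [hmi] at a2 a4
      rw [hmj] at a4
      grind
    simp only [List.nodup_append, List.mem_append]
    grind
  have N2 : (p' ++ n' ++ q').Nodup := by
    have : ∀ u ∈ n', u ∉ p' ∧ u ∉ q' := by
      intro u hu
      have a1 := hn u
      have a2 := hsj u
      have a4 := hnot u
      rw [hmj] at a2 a4
      rw [hmi] at a4
      grind
    simp only [List.nodup_append, List.mem_append]
    grind
  let N : Fin k → List V := fun l => if l = i then p ++ n ++ q else if l = j then p' ++ n' ++ q'
    else (L l).verts
  have Ni : N i = p ++ n ++ q := by simp [N]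
  have Nj : N j = p' ++ n' ++ q' := by simp [N, hij.symm]
  have No : ∀ l, l ≠ i → l ≠ j → N l = (L l).verts := by
    intro l a b; simp [N, a, b]
  have key := core L hL N ?_ ?_ ?_ ?_ ?_
  · have hmem : j ∈ Finset.univ.erase i := by simp [hij.symm]
    rw [← Finset.add_sum_erase _ _ (Finset.mem_univ i), ← Finset.add_sum_erase _ _ hmem,
      ← Finset.add_sum_erase (a := i) _ (fun l => (N l).length) (Finset.mem_univ i),
      ← Finset.add_sum_erase (a := j) _ (fun l => (N l).length) hmem] at key
    have : ∑ x ∈ (Finset.univ.erase i).erase j, (N x).length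
        = ∑ x ∈ (Finset.univ.erase i).erase j, (L x).verts.length := by
      refine Finset.sum_congr rfl fun x hx => ?_
      rw [No x (by simp at hx; tauto) (by simp at hx; tauto)]
    rw [this] at key
    simp [hP, hP', Ni, Nj] at key
    omega
  · intro l
    by_cases h : l = i
    · rw [h, Ni]; exact N1
    · by_cases h' : l = j
      · rw [h', Nj]; exact N2
      · rw [No l h h']; exact (L l).nodup
  · intro l
    by_cases h : l = i
    · rw [h, Ni]; exact hc
    · by_cases h' : l = j
      · rw [h', Nj]; exact hc'
      · rw [No l h h']; exact (L l).chain
  · intro l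
    by_cases h : l = i
    · rw [h, Ni, hP]; simp [List.head?_append, List.head?_eq_some_head hp]
    · by_cases h' : l = j
      · rw [h', Nj, hP']; simp [List.head?_append, List.head?_eq_some_head hp']
      · rw [No l h h']
  · intro l
    by_cases h : l = i
    · rw [h, Ni, hP]; simp [List.getLast?_append, List.getLast?_eq_some_getLast hq]
    · by_cases h' : l = j
      · rw [h', Nj, hP']; simp [List.getLast?_append, List.getLast?_eq_some_getLast hq']
      · rw [No l h h']
  · intro l l' hll u hu hu'
    by_cases h : l = i
    · rw [h, Ni] at hu
      by_cases h' : l' = j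
      · rw [h', Nj] at hu'; exact hnn u hu hu'
      · have : l' ≠ i := fun e => hll (h.trans e.symm)
        rw [No l' this h'] at hu'
        exact (hout l' this h' u hu').1 hu
    · by_cases h2 : l = j
      · rw [h2, Nj] at hu
        by_cases h' : l' = i
        · rw [h', Ni] at hu'; exact hnn u hu' hu
        · have : l' ≠ j := fun e => hll (h2.trans e.symm)
          rw [No l' h' this] at hu'
          exact (hout l' h' this u hu').2 hu
      · rw [No l h h2] at hu
        by_cases h' : l' = i
        · rw [h', Ni] at hu'; exact (hout l h h2 u hu).1 hu'
        · by_cases h4 : l' = j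
          · rw [h4, Nj] at hu'; exact (hout l h h2 u hu).2 hu'
          · rw [No l' h' h4] at hu'
            exact hll (h3 hu hu')

theorem chain_glue {V : Type} {R : V → V → Prop} {p m q n : List V} {x y : V}
    (h : (p ++ x :: (m ++ y :: q)).IsChain R) (h' : (x :: (n ++ [y])).IsChain R) :
    ((p ++ [x]) ++ n ++ (y :: q)).IsChain R := by
  have h1 : (p ++ [x]).IsChain R := by
    have : p ++ x :: (m ++ y :: q) = (p ++ [x]) ++ (m ++ y :: q) := by simp
    rw [this] at h
    exact h.left_of_append
  have h2 : (y :: q).IsChain R := by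
    have : p ++ x :: (m ++ y :: q) = (p ++ x :: m) ++ (y :: q) := by simp
    rw [this] at h
    exact h.right_of_append
  have h3 : (p ++ [x] ++ (n ++ [y])).IsChain R := List.IsChain.append_overlap h1 h' (by simp)
  have h4 : (p ++ [x] ++ n ++ [y] ++ q).IsChain R :=
    List.IsChain.append_overlap (by simpa using h3) (by simpa using h2) (by simp)
  simpa using h4

theorem split_sub {V : Type} {a b : V} {l P : List V} (h : (a :: (l ++ [b])).Sublist P) :
    ∃ p m q, P = p ++ a :: (m ++ b :: q) ∧ l.Sublist m := by
  rw [List.cons_sublist_iff] at h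
  obtain ⟨r1, r2, rfl, ha, h⟩ := h
  rw [List.append_sublist_iff] at h
  obtain ⟨s1, s2, rfl, hl, hb⟩ := h
  rw [List.singleton_sublist] at hb
  obtain ⟨p, r, rfl⟩ := List.append_of_mem ha
  obtain ⟨t, q, rfl⟩ := List.append_of_mem hb
  refine ⟨p, r ++ s1 ++ t, q, by simp, ?_⟩
  exact (hl.trans (List.sublist_append_right r s1)).trans (List.sublist_append_left _ _)

theorem shortcut {V : Type} {G : Dgraph V} {k : ℕ} {L : Fin k → Dpath G}
    (hL : IsMinimumLinkage L) {i : Fin k} {x y : V} {W U : List V}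
    (hs : (x :: (W ++ [y])).Sublist (L i).verts) (hc : (x :: (U ++ [y])).IsChain G.adj)
    (hU : U.Nodup) (hn : ∀ u ∈ U, u ∉ linkSupport L) : W.length ≤ U.length := by
  obtain ⟨p, m, q, hP, hm⟩ := split_sub hs
  have h0 : (L i).verts.IsChain G.adj := (L i).chain
  have h1 := single L hL i (p ++ [x]) m (y :: q) U (by simp) (by simp) (by simp [hP])
    (chain_glue (hP ▸ h0) hc) hU hn
  exact hm.length_le.trans h1

theorem back_edge {V : Type} {G : Dgraph V} {k : ℕ} {L : Fin k → Dpath G}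
    (hL : IsMinimumLinkage L) {i : Fin k} {x y : V} {W : List V} {C : Set V}
    (hC : G.IsClique C) (hx : x ∈ C) (hy : y ∈ C)
    (hs : (x :: (W ++ [y])).Sublist (L i).verts) (hW : W ≠ []) : G.adj y x := by
  have hne : x ≠ y := by
    have := hs.nodup (L i).nodup
    rintro rfl
    simp at this
  rcases hC x hx y hy hne with h | h
  · exfalso
    have := shortcut (U := []) hL hs (by simpa using h) (by simp) (by simp)
    cases W <;> simp_all
  · exact h

/-- A link: a path of at most one internal vertex, the internal vertex not in `V(L)`. -/
def Lnk {V : Type} {G : Dgraph V} {k : ℕ} (L : Fin k → Dpath G) (x : V) (U : List V) (y : V) :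
    Prop :=
  (x :: (U ++ [y])).IsChain G.adj ∧ U.length ≤ 1 ∧ ∀ u ∈ U, u ∉ linkSupport L

theorem chain_two {V : Type} {R : V → V → Prop} {U U' : List V} {x y z t : V}
    (h : (x :: (U ++ [y])).IsChain R) (h1 : R y z) (h' : (z :: (U' ++ [t])).IsChain R) :
    (x :: ((U ++ [y, z] ++ U') ++ [t])).IsChain R := by
  have a1 : ((x :: U) ++ [y] ++ [z]).IsChain R :=
    List.IsChain.append_overlap (by simpa using h) (by simpa using h1) (by simp)
  have a2 : ((x :: U ++ [y]) ++ [z] ++ (U' ++ [t])).IsChain R :=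
    List.IsChain.append_overlap (by simpa using a1) (by simpa using h') (by simp)
  simpa using a2

theorem swap {V : Type} {G : Dgraph V} {k : ℕ} {L : Fin k → Dpath G}
    (hL : IsMinimumLinkage L) {i j : Fin k} (hij : i ≠ j) {C : Set V} (hC : G.IsClique C)
    {x1 x2 x3 x4 y1 y2 y3 y4 : V} {W W' U1 U2 U3 U4 : List V}
    (hs : ([x1, x4] ++ W ++ [y3, y2]).Sublist (L i).verts)
    (hs' : ([x3, x2] ++ W' ++ [y1, y4]).Sublist (L j).verts)
    (hW : 3 ≤ W.length) (hW' : 3 ≤ W'.length)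
    (hx4 : x4 ∈ C) (hy3 : y3 ∈ C) (hx2 : x2 ∈ C) (hy1 : y1 ∈ C)
    (h1 : Lnk L x1 U1 y1) (h2 : Lnk L x2 U2 y2) (h3 : Lnk L x3 U3 y3) (h4 : Lnk L x4 U4 y4)
    (hU : (U1 ++ U2 ++ (U3 ++ U4)).Nodup) : False := by
  have hWne : W ≠ [] := by rintro rfl; simp at hW
  have hWne' : W' ≠ [] := by rintro rfl; simp at hW'
  have hb : G.adj y3 x4 := back_edge hL hC hx4 hy3 (i := i) (W := W)
    (List.Sublist.trans (by
      have : [x1, x4] ++ W ++ [y3, y2] = [x1] ++ (x4 :: (W ++ [y3])) ++ [y2] := by simp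
      rw [this]
      exact (List.sublist_append_right _ _).trans (List.sublist_append_left _ _)) hs) hWne
  have hb' : G.adj y1 x2 := back_edge hL hC hx2 hy1 (i := j) (W := W')
    (List.Sublist.trans (by
      have : [x3, x2] ++ W' ++ [y1, y4] = [x3] ++ (x2 :: (W' ++ [y1])) ++ [y4] := by simp
      rw [this]
      exact (List.sublist_append_right _ _).trans (List.sublist_append_left _ _)) hs') hWne'
  obtain ⟨p, m, q, hP, hm⟩ := split_sub (a := x1) (b := y2) (l := x4 :: W ++ [y3])
    (by simpa using hs)
  obtain ⟨p', m', q', hP', hm'⟩ := split_sub (a := x3) (b := y4) (l := x2 :: W' ++ [y1])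
    (by simpa using hs')
  have c0 : (L i).verts.IsChain G.adj := (L i).chain
  have c0' : (L j).verts.IsChain G.adj := (L j).chain
  have mx4 : x4 ∈ m := hm.subset (by simp)
  have my3 : y3 ∈ m := hm.subset (by simp)
  have mx2 : x2 ∈ m' := hm'.subset (by simp)
  have my1 : y1 ∈ m' := hm'.subset (by simp)
  have pi : ∀ u ∈ m, u ∈ (L i).verts := fun u hu => by rw [hP]; simp [hu]
  have pj : ∀ u ∈ m', u ∈ (L j).verts := fun u hu => by rw [hP']; simp [hu]
  have hsi : ∀ u ∈ m, u ∈ linkSupport L := fun u hu => Set.mem_iUnion.2 ⟨i, pi u hu⟩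
  have hsj : ∀ u ∈ m', u ∈ linkSupport L := fun u hu => Set.mem_iUnion.2 ⟨j, pj u hu⟩
  have hdis : ∀ u ∈ m, ∀ u' ∈ m', u ≠ u' := by
    rintro u hu _ hu' rfl
    exact hij (mem_uniq hL.1 (pi u hu) (pj u hu'))
  have n1 : x4 ≠ y3 := by
    have := (hs.nodup (L i).nodup); rintro rfl; simp at this
  have n2 : x2 ≠ y1 := by
    have := (hs'.nodup (L j).nodup); rintro rfl; simp at this
  have key := double L hL i j hij (p ++ [x1]) m (y2 :: q) (U1 ++ [y1, x2] ++ U2)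
    (p' ++ [x3]) m' (y4 :: q') (U3 ++ [y3, x4] ++ U4) (by simp) (by simp) (by simp) (by simp)
    (by simp [hP]) (by simp [hP'])
    (chain_glue (hP ▸ c0) (chain_two h1.1 hb' h2.1))
    (chain_glue (hP' ▸ c0') (chain_two h3.1 hb h4.1))
    (by
      have e : (U1 ++ [y1, x2] ++ U2 ++ (U3 ++ [y3, x4] ++ U4)).Perm
          ((U1 ++ U2 ++ (U3 ++ U4)) ++ [y1, x2, y3, x4]) := by
        rw [List.perm_iff_count]
        intro a
        simp [List.count_append, List.count_cons]
        omega
      rw [e.nodup_iff, List.nodup_append]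
      refine ⟨hU, ?_, ?_⟩
      · have a1 := hdis _ mx4 _ mx2
        have a2 := hdis _ mx4 _ my1
        have a3 := hdis _ my3 _ mx2
        have a4 := hdis _ my3 _ my1
        simp
        grind
      · have b1 := h1.2.2
        have b2 := h2.2.2
        have b3 := h3.2.2
        have b4 := h4.2.2
        rintro u hu v hv rfl
        have : u ∉ linkSupport L := by
          simp only [List.mem_append] at hu
          grind
        simp at hv
        rcases hv with rfl | rfl | rfl | rfl
        · exact this (hsj _ my1)
        · exact this (hsj _ mx2)
        · exact this (hsi _ my3)
        · exact this (hsi _ mx4))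
    (by
      intro u hu
      have b1 := h1.2.2 u
      have b2 := h2.2.2 u
      have b3 := h3.2.2 u
      have b4 := h4.2.2 u
      simp at hu
      grind)
  have l1 := hm.length_le
  have l2 := hm'.length_le
  have b1 := h1.2.1
  have b2 := h2.2.1
  have b3 := h3.2.1
  have b4 := h4.2.1
  simp at key l1 l2
  omega

theorem no_match {V : Type} {G : Dgraph V} {k : ℕ} {L : Fin k → Dpath G} {sv tv : Fin k → V}
    {C B : Set V} (hacc : CAcceptable sv tv L C B) {i j : Fin k}
    (xs ys : Fin (k ^ 2 + k + 2) → V) (us : Fin (k ^ 2 + k + 2) → List V)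
    (hx : (List.ofFn xs).Sublist (L i).verts) (hy : (List.ofFn ys).Sublist (L j).verts)
    (hxB : ∀ t, xs t ∈ B) (hyA : ∀ t, ys t ∈ C \ B)
    (hl : ∀ t, Lnk L (xs t) (us t) (ys t))
    (hd : ∀ t t', t ≠ t' → ∀ u ∈ us t, u ∉ us t') : False := by
  have hxL : ∀ t, xs t ∈ linkSupport L := fun t =>
    Set.mem_iUnion.2 ⟨i, hx.subset (by rw [List.mem_ofFn]; exact ⟨t, rfl⟩)⟩
  have hyL : ∀ t, ys t ∈ linkSupport L := fun t =>
    Set.mem_iUnion.2 ⟨j, hy.subset (by rw [List.mem_ofFn]; exact ⟨t, rfl⟩)⟩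
  have hxi : Function.Injective xs := List.nodup_ofFn.1 (hx.nodup (L i).nodup)
  have hyi : Function.Injective ys := List.nodup_ofFn.1 (hy.nodup (L j).nodup)
  have hxy : ∀ t t', xs t ≠ ys t' := fun t t' h => (hyA t').2 (h ▸ hxB t)
  have hnx : ∀ t, ∀ u ∈ us t, ∀ t', u ≠ xs t' := fun t u hu t' h =>
    (hl t).2.2 u hu (h ▸ hxL t')
  have hny : ∀ t, ∀ u ∈ us t, ∀ t', u ≠ ys t' := fun t u hu t' h =>
    (hl t).2.2 u hu (h ▸ hyL t')
  have hnd : ∀ t, (xs t :: (us t ++ [ys t])).Nodup := by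
    intro t
    have h1 := (hl t).2.1
    have h2 := hnx t
    have h3 := hny t
    have h4 := hxy t t
    match h : us t with
    | [] => simp [h4]
    | [u] =>
      have h5 := h2 u (by simp [h]) t
      have h6 := h3 u (by simp [h]) t
      simp [h4, h5.symm, h6]
    | _ :: _ :: _ => simp [h] at h1
  let M : Fin (k ^ 2 + k + 2) → Dpath G := fun t =>
    ⟨xs t :: (us t ++ [ys t]), by simp, hnd t, (hl t).1⟩
  have hMf : ∀ t, (M t).first = xs t := fun t => rfl
  have hMl : ∀ t, (M t).last = ys t := fun t => by
    simp [M, Dpath.last]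
  refine hacc.2.2.2.2 i j ⟨M, ⟨⟨?_, ?_, ?_, ?_⟩, ?_⟩, ?_⟩
  · intro t t' ht
    rw [Set.disjoint_left]
    intro v hv hv'
    have a1 := hxi.ne ht
    have a2 := hyi.ne ht
    have a3 := hxy t t'
    have a4 := hxy t' t
    have a5 := hd t t' ht v
    have a6 := hnx t v
    have a7 := hny t v
    have a8 := hnx t' v
    have a9 := hny t' v
    simp [M, Dpath.support] at hv hv'
    grind
  · intro t
    have h1 := (hl t).2.1
    simp [M]
    omega
  · simpa only [hMf] using hx
  · simpa only [hMl] using hy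
  · intro t
    rw [hMf, hMl]
    exact ⟨hxB t, hyA t⟩
  · intro v hv
    obtain ⟨hv1, hv2⟩ := hv
    obtain ⟨t, ht⟩ := Set.mem_iUnion.1 hv1
    simp only [Set.mem_union, Set.mem_range, hMf, hMl, not_or, not_exists] at hv2
    have b1 := hv2.1 t
    have b2 := hv2.2 t
    simp [M, Dpath.support] at ht
    rcases ht with h | h | h
    · exact absurd h.symm b1
    · exact (hl t).2.2 v h
    · exact absurd h.symm b2

theorem sort_list {V : Type} {P : List V} (hP : P.Nodup) {F : Finset V} (hF : ∀ v ∈ F, v ∈ P)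
    {m : ℕ} (hm : F.card = m) :
    ∃ xs : Fin m → V, (List.ofFn xs).Sublist P ∧ ∀ t, xs t ∈ F := by
  let l := P.filter (fun v => decide (v ∈ F))
  have hl : l.Nodup := hP.filter _
  have h1 : l.toFinset = F := by
    ext v
    simp only [l, List.mem_toFinset, List.mem_filter, decide_eq_true_eq]
    exact ⟨fun h => h.2, fun h => ⟨hF v h, h⟩⟩
  have h2 : l.length = m := by
    rw [← hm, ← h1, List.toFinset_card_of_nodup hl]
  subst h2
  refine ⟨fun t => l.get t, ?_, ?_⟩
  · rw [List.ofFn_get]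
    exact List.filter_sublist
  · intro t
    rw [← h1]
    simp

theorem reps {V : Type} {G : Dgraph V} {k n m : ℕ} {L : Fin k → Dpath G} {i : Fin k}
    {B : Set V} {Y : List V} {F : Finset V} (hm : F.card = m) (hmn : m ≤ n)
    (hF : ∀ v ∈ F, (v ∈ (L i).verts ∧ v ∈ B) ∨ (v ∉ linkSupport L ∧ ∃ X : List V,
      X.length = n ∧ X.Sublist (L i).verts ∧ ∀ u ∈ X, u ∈ B ∧ G.adj u v))
    (hY : ∀ v ∈ F, ∀ y ∈ Y, G.adj v y) :
    ∃ (xs : Fin m → V) (us : Fin m → List V), (List.ofFn xs).Sublist (L i).verts ∧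
      (∀ t, xs t ∈ B ∧ ∀ y ∈ Y, Lnk L (xs t) (us t) y) ∧
      (∀ t t', t ≠ t' → ∀ u ∈ us t, u ∉ us t') ∧ (∀ t, ∀ u ∈ us t, u ∈ F) := by
  have hF' : ∀ v : F, ∃ X : Finset V, ((X = {v.1} ∧ v.1 ∈ linkSupport L) ∨
      (v.1 ∉ linkSupport L ∧ X.card = n ∧ ∀ u ∈ X, G.adj u v)) ∧
      ∀ u ∈ X, u ∈ (L i).verts ∧ u ∈ B := by
    rintro ⟨v, hv⟩
    rcases hF v hv with h | ⟨h, X, hX, hXs, hXa⟩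
    · exact ⟨{v}, Or.inl ⟨rfl, Set.mem_iUnion.2 ⟨i, h.1⟩⟩, by simpa using h⟩
    · refine ⟨X.toFinset, Or.inr ⟨h, ?_, ?_⟩, ?_⟩
      · rw [List.toFinset_card_of_nodup (hXs.nodup (L i).nodup), hX]
      · intro u hu
        exact (hXa u (by simpa using hu)).2
      · intro u hu
        exact ⟨hXs.subset (by simpa using hu), (hXa u (by simpa using hu)).1⟩
  choose X hX hXB using hF'
  obtain ⟨f, hfi, hf⟩ := (Finset.all_card_le_biUnion_card_iff_exists_injective X).1 (by
    intro s
    by_cases h : ∃ v ∈ s, v.1 ∉ linkSupport L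
    · obtain ⟨v, hv, hvL⟩ := h
      have h1 : (X v).card = n := by
        rcases hX v with h | h
        · exact absurd h.2 hvL
        · exact h.2.1
      have h2 : s.card ≤ m := by
        rw [← hm, ← Fintype.card_coe F]
        exact Finset.card_le_univ s
      have h3 := Finset.card_le_card (Finset.subset_biUnion_of_mem X hv)
      omega
    · push Not at h
      have h1 : s.biUnion X = s.map ⟨Subtype.val, Subtype.val_injective⟩ := by
        ext u
        simp only [Finset.mem_biUnion, Finset.mem_map, Function.Embedding.coeFn_mk]
        have : ∀ v ∈ s, X v = {v.1} := by
          intro v hv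
          rcases hX v with h' | h'
          · exact h'.1
          · exact absurd (h v hv) h'.1
        constructor
        · rintro ⟨v, hv, hu⟩
          rw [this v hv, Finset.mem_singleton] at hu
          exact ⟨v, hv, hu.symm⟩
        · rintro ⟨v, hv, hu⟩
          exact ⟨v, hv, by rw [this v hv, Finset.mem_singleton]; exact hu.symm⟩
      rw [h1, Finset.card_map])
  have hI : (Finset.univ.image f).card = m := by
    rw [Finset.card_image_of_injective _ hfi, Finset.card_univ, Fintype.card_coe, hm]
  obtain ⟨xs, hxs, hxm⟩ := sort_list (P := (L i).verts) (L i).nodup (F := Finset.univ.image f)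
    (by
      intro v hv
      simp only [Finset.mem_image, Finset.mem_univ, true_and] at hv
      obtain ⟨a, rfl⟩ := hv
      exact (hXB a _ (hf a)).1) hI
  have hg : ∀ t, ∃ v : F, f v = xs t := by
    intro t
    have := hxm t
    simpa using this
  choose g hg using hg
  have hxi : Function.Injective xs := List.nodup_ofFn.1 (hxs.nodup (L i).nodup)
  have hgi : Function.Injective g := by
    intro t t' h
    apply hxi
    rw [← hg, ← hg, h]
  refine ⟨xs, fun t => if (g t).1 ∈ linkSupport L then [] else [(g t).1], hxs, ?_, ?_, ?_⟩
  · intro t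
    have h1 := hf (g t)
    rw [hg] at h1
    refine ⟨(hXB _ _ h1).2, fun y hy => ?_⟩
    have h2 := hY (g t).1 (g t).2 y hy
    rcases hX (g t) with h | h
    · rw [h.1, Finset.mem_singleton] at h1
      simp only [h.2, if_true]
      refine ⟨?_, by simp, by simp⟩
      simpa [h1] using h2
    · simp only [h.1, if_false]
      refine ⟨?_, by simp, by simpa using h.1⟩
      simpa using ⟨h.2.2 _ h1, h2⟩
  · intro t t' htt u hu hu'
    have : (g t).1 ≠ (g t').1 := fun h => htt (hgi (Subtype.ext h))
    beta_reduce at hu hu'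
    split_ifs at hu hu' <;> simp_all
  · intro t u hu
    beta_reduce at hu
    split_ifs at hu
    · simp at hu
    · simp only [List.mem_singleton] at hu
      rw [hu]; exact (g t).2

theorem order_append {V : Type} {G : Dgraph V} {k : ℕ} {L : Fin k → Dpath G} {sv tv : Fin k → V}
    {C B : Set V} (hacc : CAcceptable sv tv L C B) {i : Fin k} {l l' : List V}
    (hl : l.Sublist (L i).verts) (hl' : l'.Sublist (L i).verts)
    (hB : ∀ u ∈ l, u ∈ B) (hA : ∀ u ∈ l', u ∈ C \ B) : (l ++ l').Sublist (L i).verts := by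
  obtain ⟨Q, ⟨r, hr⟩, hQ⟩ := hacc.2.2.2.1 i
  have hnd := (L i).nodup
  rw [← hr] at hl hl' hnd ⊢
  have hdis := (List.nodup_append.1 hnd).2.2
  have hin : ∀ u ∈ (L i).verts, u ∈ B → u ∈ Q.verts := by
    intro u hu huB
    have : u ∈ Q.support ∩ C := by rw [hQ]; exact ⟨hu, huB⟩
    exact this.1
  have hout : ∀ u, u ∈ C \ B → u ∉ Q.verts := by
    intro u hu huQ
    have : u ∈ (L i).support ∩ B := by rw [← hQ]; exact ⟨huQ, hu.1⟩
    exact hu.2 this.2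
  obtain ⟨a, b, rfl, ha, hb⟩ := List.sublist_append_iff.1 hl
  obtain ⟨a', b', rfl, ha', hb'⟩ := List.sublist_append_iff.1 hl'
  have hb0 : b = [] := by
    rw [List.eq_nil_iff_forall_not_mem]
    intro u hu
    exact hdis u (hin u (by rw [← hr]; simp [hb.subset hu]) (hB u (by simp [hu]))) u
      (hb.subset hu) rfl
  have ha0 : a' = [] := by
    rw [List.eq_nil_iff_forall_not_mem]
    intro u hu
    exact hout u (hA u (by simp [hu])) (ha'.subset hu)
  subst hb0 ha0
  simpa using List.Sublist.append ha hb'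

/-- The members of `F` in the `(i,Y)` fibre of the first kind. -/
def FibB {V : Type} {G : Dgraph V} {k : ℕ} (L : Fin k → Dpath G) (n : ℕ) (i : Fin k)
    (B : Set V) (Y : List V) (F : Finset V) : Prop :=
  (∀ v ∈ F, (v ∈ (L i).verts ∧ v ∈ B) ∨ (v ∉ linkSupport L ∧ ∃ X : List V,
      X.length = n ∧ X.Sublist (L i).verts ∧ ∀ u ∈ X, u ∈ B ∧ G.adj u v)) ∧
    (∀ v ∈ F, ∀ y ∈ Y, G.adj v y)

theorem FibB.mono {V : Type} {G : Dgraph V} {k : ℕ} {L : Fin k → Dpath G} {n : ℕ} {i : Fin k}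
    {B : Set V} {Y : List V} {F F' : Finset V} (h : FibB L n i B Y F) (hF : F' ⊆ F) :
    FibB L n i B Y F' :=
  ⟨fun v hv => h.1 v (hF hv), fun v hv => h.2 v (hF hv)⟩

/-- The members of `F` in the `(X,j)` fibre of the second kind. -/
def FibA {V : Type} {G : Dgraph V} {k : ℕ} (L : Fin k → Dpath G) (j : Fin k)
    (A : Set V) (X : List V) (F : Finset V) : Prop :=
  ∀ v ∈ F, v ∈ (L j).verts ∧ v ∈ A ∧ ∀ x ∈ X, G.adj x v

theorem ofFn_list {V : Type} {n : ℕ} {Y : List V} (h : Y.length = n) :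
    ∃ ys : Fin n → V, List.ofFn ys = Y ∧ ∀ t, ys t ∈ Y := by
  subst h
  exact ⟨Y.get, List.ofFn_get Y, fun t => List.get_mem Y t⟩

theorem fibB_card {V : Type} {G : Dgraph V} {k : ℕ} {L : Fin k → Dpath G} {sv tv : Fin k → V}
    {C B : Set V} (hacc : CAcceptable sv tv L C B) {i j : Fin k} {Y : List V} {F : Finset V}
    (hY : Y.length = k ^ 2 + k + 2) (hYs : Y.Sublist (L j).verts) (hYA : ∀ y ∈ Y, y ∈ C \ B)
    (hF : FibB L (k ^ 2 + k + 2) i B Y F) : F.card ≤ k ^ 2 + k + 1 := by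
  by_contra hcon
  obtain ⟨F', hF', hc⟩ := Finset.exists_subset_card_eq (show k ^ 2 + k + 2 ≤ F.card by omega)
  obtain ⟨xs, us, h1, h2, h3, h4⟩ := reps hc le_rfl (hF.mono hF').1 (hF.mono hF').2
  obtain ⟨ys, rfl, hys⟩ := ofFn_list hY
  exact no_match hacc xs ys us h1 hYs (fun t => (h2 t).1) (fun t => hYA _ (hys t))
    (fun t => (h2 t).2 _ (hys t)) h3

theorem nodup_short {V : Type} {U : List V} (h : U.length ≤ 1) : U.Nodup := by
  match U with
  | [] => simp
  | [u] => simp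
  | _ :: _ :: _ => simp at h

theorem split_last {V : Type} {Y : List V} {n : ℕ} (h : Y.length = n + 2) :
    ∃ W y y', Y = W ++ [y, y'] ∧ W.length = n := by
  refine ⟨Y.take n, Y[n], Y[n+1], ?_, by simp [h]⟩
  apply List.ext_getElem
  · simp [h]
  · intro i h1 h2
    grind

theorem split_first {V : Type} {Y : List V} {n : ℕ} (h : Y.length = n + 2) :
    ∃ W y y', Y = [y, y'] ++ W ∧ W.length = n := by
  match Y with
  | y :: y' :: W => exact ⟨W, y, y', rfl, by simpa using h⟩
  | [] => simp at h
  | [_] => simp at h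

theorem fibB_diag {V : Type} {G : Dgraph V} {k n : ℕ} {L : Fin k → Dpath G} {sv tv : Fin k → V}
    (hL : IsMinimumLinkage L)
    {C B : Set V} (hacc : CAcceptable sv tv L C B) {i : Fin k} {Y : List V} {v : V}
    (hY : Y.length = n + 2) (hYs : Y.Sublist (L i).verts) (hYA : ∀ y ∈ Y, y ∈ C \ B)
    (hn : 1 ≤ n)
    (hF : FibB L (n + 2) i B Y {v}) : False := by
  obtain ⟨xs, us, h1, h2, h3, h4⟩ := reps (m := 1) (by simp) (by omega) hF.1 hF.2
  have hs := order_append hacc h1 hYs (by simpa using (h2 0).1) hYA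
  obtain ⟨W, y, y', rfl, hW⟩ := split_last hY
  have hl := (h2 0).2 y' (by simp)
  have := shortcut hL (x := xs 0) (y := y') (W := W ++ [y]) (U := us 0) (by simpa using hs) hl.1
    (nodup_short hl.2.1) hl.2.2
  have := hl.2.1
  simp at *
  omega

theorem nodup_four {V : Type} {us us' : Fin 2 → List V} (e1 : (us 0).Nodup) (e2 : (us' 1).Nodup)
    (e3 : (us' 0).Nodup) (e4 : (us 1).Nodup)
    (d1 : ∀ u ∈ us 0, u ∉ us 1) (d2 : ∀ u ∈ us' 0, u ∉ us' 1)
    (dd : ∀ t t', ∀ u ∈ us t, u ∉ us' t') :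
    (us 0 ++ us' 1 ++ (us' 0 ++ us 1)).Nodup := by
  have f1 := dd 0 0
  have f2 := dd 0 1
  have f3 := dd 1 0
  have f4 := dd 1 1
  clear dd
  generalize us 0 = p at *
  generalize us 1 = q at *
  generalize us' 0 = r at *
  generalize us' 1 = t at *
  rw [List.nodup_append, List.nodup_append, List.nodup_append]
  refine ⟨⟨e1, e2, ?_⟩, ⟨e3, e4, ?_⟩, ?_⟩
  · rintro a ha b hb rfl; exact f2 a ha hb
  · rintro a ha b hb rfl; exact f3 a hb ha
  · rintro a ha b hb rfl
    rcases List.mem_append.1 ha with ha | ha <;> rcases List.mem_append.1 hb with hb | hb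
    · exact f1 a ha hb
    · exact d1 a ha hb
    · exact d2 a hb ha
    · exact f4 a hb ha

theorem fibB_swap {V : Type} {G : Dgraph V} {k n : ℕ} {L : Fin k → Dpath G} {sv tv : Fin k → V}
    (hL : IsMinimumLinkage L)
    {C B : Set V} (hC : G.IsClique C) (hacc : CAcceptable sv tv L C B) {i j : Fin k} (hij : i ≠ j)
    {Y Y' : List V} {F F' : Finset V} (hn : 3 ≤ n)
    (hY : Y.length = n + 2) (hYs : Y.Sublist (L j).verts) (hYA : ∀ y ∈ Y, y ∈ C \ B)
    (hY' : Y'.length = n + 2) (hYs' : Y'.Sublist (L i).verts) (hYA' : ∀ y ∈ Y', y ∈ C \ B)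
    (hF : FibB L (n + 2) i B Y F) (hF' : FibB L (n + 2) j B Y' F') (hdis : ∀ v ∈ F, v ∉ F')
    (h2 : 2 ≤ F.card) (h2' : 2 ≤ F'.card) : False := by
  obtain ⟨F1, hF1, hc1⟩ := Finset.exists_subset_card_eq h2
  obtain ⟨F2, hF2, hc2⟩ := Finset.exists_subset_card_eq h2'
  obtain ⟨xs, us, a1, a2, a3, a4⟩ := reps hc1 (by omega) (hF.mono hF1).1 (hF.mono hF1).2
  obtain ⟨xs', us', b1, b2, b3, b4⟩ := reps hc2 (by omega) (hF'.mono hF2).1 (hF'.mono hF2).2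
  have hs := order_append hacc a1 hYs' (by
    intro u hu; rw [List.mem_ofFn] at hu; obtain ⟨t, rfl⟩ := hu; exact (a2 t).1) hYA'
  have hs' := order_append hacc b1 hYs (by
    intro u hu; rw [List.mem_ofFn] at hu; obtain ⟨t, rfl⟩ := hu; exact (b2 t).1) hYA
  obtain ⟨W, y, z, rfl, hW⟩ := split_last hY
  obtain ⟨W', y', z', rfl, hW'⟩ := split_last hY'
  have hBC := hacc.1
  have e1 := nodup_short (((a2 0).2 y (by simp)).2.1)
  have e2 := nodup_short (((a2 1).2 y (by simp)).2.1)
  have e3 := nodup_short (((b2 0).2 y' (by simp)).2.1)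
  have e4 := nodup_short (((b2 1).2 y' (by simp)).2.1)
  have d1 := a3 0 1 (by simp)
  have d2 := b3 0 1 (by simp)
  have dd : ∀ t t', ∀ u ∈ us t, u ∉ us' t' := fun t t' u hu hu' =>
    hdis u (hF1 (a4 t u hu)) (hF2 (b4 t' u hu'))
  refine swap hL hij hC (x1 := xs 0) (x4 := xs 1) (x3 := xs' 0) (x2 := xs' 1)
    (y1 := y) (y4 := z) (y3 := y') (y2 := z') (W := W') (W' := W)
    (U1 := us 0) (U4 := us 1) (U3 := us' 0) (U2 := us' 1)
    (by simpa using hs) (by simpa using hs') (by omega) (by omega)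
    (hBC (a2 1).1) (hYA' y' (by simp)).1 (hBC (b2 1).1) (hYA y (by simp)).1
    ((a2 0).2 y (by simp)) ((b2 1).2 z' (by simp)) ((b2 0).2 y' (by simp)) ((a2 1).2 z (by simp)) ?_
  exact nodup_four e1 e4 e3 e2 d1 d2 dd

theorem fibA_card {V : Type} {G : Dgraph V} {k : ℕ} {L : Fin k → Dpath G} {sv tv : Fin k → V}
    {C B : Set V} (hacc : CAcceptable sv tv L C B) {i j : Fin k} {X : List V} {F : Finset V}
    (hX : X.length = k ^ 2 + k + 2) (hXs : X.Sublist (L i).verts) (hXB : ∀ x ∈ X, x ∈ B)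
    (hF : FibA L j (C \ B) X F) : F.card ≤ k ^ 2 + k + 1 := by
  by_contra hcon
  obtain ⟨F', hF', hc⟩ := Finset.exists_subset_card_eq (show k ^ 2 + k + 2 ≤ F.card by omega)
  obtain ⟨ys, h1, h2⟩ := sort_list (L j).nodup (fun v hv => (hF v (hF' hv)).1) hc
  obtain ⟨xs, rfl, hxs⟩ := ofFn_list hX
  refine no_match hacc xs ys (fun _ => []) hXs h1 (fun t => hXB _ (hxs t))
    (fun t => (hF _ (hF' (h2 t))).2.1) (fun t => ⟨?_, by simp, by simp⟩) (by simp)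
  simpa using (hF _ (hF' (h2 t))).2.2 _ (hxs t)

theorem fibA_diag {V : Type} {G : Dgraph V} {k n : ℕ} {L : Fin k → Dpath G} {sv tv : Fin k → V}
    (hL : IsMinimumLinkage L)
    {C B : Set V} (hacc : CAcceptable sv tv L C B) {i : Fin k} {X : List V} {v : V}
    (hX : X.length = n + 2) (hXs : X.Sublist (L i).verts) (hXB : ∀ x ∈ X, x ∈ B)
    (hF : FibA L i (C \ B) X {v}) : False := by
  obtain ⟨h1, h2, h3⟩ := hF v (by simp)
  have hs := order_append hacc hXs (List.singleton_sublist.2 h1) hXB (by simpa using h2)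
  obtain ⟨W, y, y', rfl, hW⟩ := split_first hX
  have := shortcut hL (x := y) (y := v) (W := y' :: W) (U := []) (by simpa using hs)
    (by simpa using h3 y (by simp)) (by simp) (by simp)
  simp at this

theorem fibA_swap {V : Type} {G : Dgraph V} {k n : ℕ} {L : Fin k → Dpath G} {sv tv : Fin k → V}
    (hL : IsMinimumLinkage L)
    {C B : Set V} (hC : G.IsClique C) (hacc : CAcceptable sv tv L C B) {i j : Fin k} (hij : i ≠ j)
    {X X' : List V} {F F' : Finset V} (hn : 3 ≤ n)
    (hX : X.length = n + 2) (hXs : X.Sublist (L i).verts) (hXB : ∀ x ∈ X, x ∈ B)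
    (hX' : X'.length = n + 2) (hXs' : X'.Sublist (L j).verts) (hXB' : ∀ x ∈ X', x ∈ B)
    (hF : FibA L j (C \ B) X F) (hF' : FibA L i (C \ B) X' F')
    (h2 : 2 ≤ F.card) (h2' : 2 ≤ F'.card) : False := by
  obtain ⟨F1, hF1, hc1⟩ := Finset.exists_subset_card_eq h2
  obtain ⟨F2, hF2, hc2⟩ := Finset.exists_subset_card_eq h2'
  obtain ⟨ys, a1, a2⟩ := sort_list (L j).nodup (fun v hv => (hF v (hF1 hv)).1) hc1
  obtain ⟨ys', b1, b2⟩ := sort_list (L i).nodup (fun v hv => (hF' v (hF2 hv)).1) hc2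
  have g := fun t => hF _ (hF1 (a2 t))
  have g' := fun t => hF' _ (hF2 (b2 t))
  have hs := order_append hacc hXs b1 hXB (by
    intro u hu; rw [List.mem_ofFn] at hu; obtain ⟨t, rfl⟩ := hu; exact (g' t).2.1)
  have hs' := order_append hacc hXs' a1 hXB' (by
    intro u hu; rw [List.mem_ofFn] at hu; obtain ⟨t, rfl⟩ := hu; exact (g t).2.1)
  obtain ⟨W, x1, x4, rfl, hW⟩ := split_first hX
  obtain ⟨W', x3, x2, rfl, hW'⟩ := split_first hX'
  have hBC := hacc.1
  refine swap hL hij hC (x1 := x1) (x4 := x4) (x3 := x3) (x2 := x2)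
    (y1 := ys 0) (y4 := ys 1) (y3 := ys' 0) (y2 := ys' 1) (W := W) (W' := W')
    (U1 := []) (U4 := []) (U3 := []) (U2 := [])
    (by simpa using hs) (by simpa using hs') (by omega) (by omega)
    (hBC (hXB _ (by simp))) (g' 0).2.1.1 (hBC (hXB' _ (by simp))) (g 0).2.1.1
    ⟨by simpa using (g 0).2.2 x1 (by simp), by simp, by simp⟩
    ⟨by simpa using (g' 1).2.2 x2 (by simp), by simp, by simp⟩
    ⟨by simpa using (g' 0).2.2 x3 (by simp), by simp, by simp⟩
    ⟨by simpa using (g 1).2.2 x4 (by simp), by simp, by simp⟩ (by simp)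

/-- `Q` is a maximal subpath of `P` with vertex set included in `S`. -/
def IsSeg {V : Type} {G : Dgraph V} (P : Dpath G) (S : Set V) (Q : Dpath G) : Prop :=
  Q.IsSubpath P ∧ Q.support ⊆ S ∧
    ∀ Q' : Dpath G, Q'.IsSubpath P → Q'.support ⊆ S → Q.IsSubpath Q' → Q'.verts = Q.verts

/-- consecutive pairs going from `A` to `B` -/
noncomputable def drops {V : Type} (A B : Set V) (l : List V) : List (V × V) :=
  open scoped Classical in (l.zip l.tail).filter fun p => decide (p.1 ∈ A ∧ p.2 ∈ B)

theorem drops_cons {V : Type} (A B : Set V) (a b : V) (l : List V) :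
    drops A B (a :: b :: l) =
      open scoped Classical in
      if a ∈ A ∧ b ∈ B then (a, b) :: drops A B (b :: l) else drops A B (b :: l) := by
  simp [drops, List.filter_cons]

theorem alternating_cons {V : Type} {A B : Set V} {a b : V} {l : List V} (ha : a ∈ A) (hb : b ∈ B)
    (hl : Alternating A B l) : Alternating A B (a :: b :: l) := by
  intro i hi
  match i, hi with
  | 0, _ => simpa using ha
  | 1, _ => simpa using hb
  | i + 2, hi =>
    have := hl i (by simpa using hi)
    simpa using this

theorem drops_alt {V : Type} {A B : Set V} (hAB : ∀ x ∈ A, x ∉ B) : ∀ l : List V,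
    ∃ m : List V, m.Sublist l ∧ m.length = 2 * (drops A B l).length ∧ Alternating A B m
  | [] => ⟨[], by simp [drops, Alternating]⟩
  | [a] => ⟨[], by simp [drops, Alternating]⟩
  | a :: b :: l => by
    obtain ⟨m, h1, h2, h3⟩ := drops_alt hAB (b :: l)
    rw [drops_cons]
    split_ifs with h
    · refine ⟨a :: b :: m, ?_, by simp [h2]; ring, alternating_cons h.1 h.2 h3⟩
      refine List.Sublist.cons_cons _ (List.Sublist.cons_cons _ ?_)
      cases m with
      | nil => simp
      | cons x m =>
        have hx : x ∈ A := by simpa using h3 0 (by simp)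
        cases h1 with
        | cons _ h => exact h
        | cons_cons _ h' => exact absurd h.2 (hAB _ hx)
    · exact ⟨m, h1.cons _, h2, h3⟩

theorem drops_le {V : Type} {G : Dgraph V} {A B : Set V} (hAB : ∀ x ∈ A, x ∉ B) (P : Dpath G) :
    (drops A B P.verts).length ≤ wiggle P A B := by
  refine le_csSup ⟨P.verts.length, ?_⟩ (drops_alt hAB P.verts)
  rintro m ⟨l, h1, h2, _⟩
  have := h1.length_le
  omega

theorem mem_zip_tail {V : Type} (x y : V) (t : List V) : ∀ p : List V,
    (x, y) ∈ (p ++ x :: y :: t).zip (p ++ x :: y :: t).tail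
  | [] => by simp
  | [a] => by simp
  | a :: b :: p => by
    have := mem_zip_tail x y t (b :: p)
    simp only [List.cons_append, List.tail_cons, List.zip_cons_cons, List.mem_cons] at this ⊢
    exact Or.inr this

theorem seg_next {V : Type} {G : Dgraph V} {P Q : Dpath G} {S : Set V} (h : IsSeg P S Q)
    {p t : List V} {b : V} (he : P.verts = p ++ Q.verts ++ b :: t) : b ∉ S := by
  intro hb
  have hi : (Q.verts ++ [b]) <:+: P.verts := ⟨p, t, by rw [he]; simp⟩
  have := h.2.2 ⟨Q.verts ++ [b], by simp, P.nodup.sublist hi.sublist, P.chain.infix hi⟩ hi (by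
    intro x hx
    have hx : x ∈ Q.verts ++ [b] := hx
    rcases List.mem_append.1 hx with hx | hx
    · exact h.2.1 hx
    · simp at hx; exact hx ▸ hb) ⟨[], [b], by simp⟩
  simpa using congrArg List.length this

theorem seg_prev {V : Type} {G : Dgraph V} {P Q : Dpath G} {S : Set V} (h : IsSeg P S Q)
    {p t : List V} {b : V} (he : P.verts = p ++ b :: Q.verts ++ t) : b ∉ S := by
  intro hb
  have hi : (b :: Q.verts) <:+: P.verts := ⟨p, t, by rw [he]⟩
  have := h.2.2 ⟨b :: Q.verts, by simp, P.nodup.sublist hi.sublist, P.chain.infix hi⟩ hi (by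
    intro x hx
    have hx : x ∈ b :: Q.verts := hx
    rcases List.mem_cons.1 hx with hx | hx
    · exact hx ▸ hb
    · exact h.2.1 hx) ⟨[b], [], by simp⟩
  simpa using congrArg List.length this

theorem seg_last_mem {V : Type} {G : Dgraph V} {P Q : Dpath G} {A B : Set V} (h : IsSeg P A Q)
    (hP : ∀ x ∈ P.verts, x ∉ A → x ∈ B) :
    Q.last ∈ P.last :: (drops A B P.verts).map Prod.fst := by
  obtain ⟨p, t, he⟩ := h.1
  have hq : Q.verts = Q.verts.dropLast ++ [Q.last] := (List.dropLast_append_getLast Q.ne).symm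
  have hA : Q.last ∈ A := h.2.1 (show Q.last ∈ Q.verts from List.getLast_mem Q.ne)
  cases t with
  | nil =>
    have : P.last = Q.last := by
      unfold Dpath.last
      have hne := Q.ne
      simp only [List.append_nil] at he
      simp only [← he]
      rw [List.getLast_append_of_ne_nil _ hne]
    simp [this]
  | cons b t =>
    have hb := seg_next h he.symm
    have hb' := hP b (by rw [← he]; simp) hb
    refine List.mem_cons_of_mem _ (List.mem_map.2 ⟨(Q.last, b), ?_, rfl⟩)
    have := mem_zip_tail Q.last b t (p ++ Q.verts.dropLast)
    have e : p ++ Q.verts.dropLast ++ Q.last :: b :: t = P.verts := by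
      rw [← he]
      conv_rhs => rw [hq]
      simp
    rw [e] at this
    simp only [drops, List.mem_filter, decide_eq_true_eq]
    exact ⟨this, hA, hb'⟩

theorem seg_first_mem {V : Type} {G : Dgraph V} {P Q : Dpath G} {A B : Set V} (h : IsSeg P B Q)
    (hP : ∀ x ∈ P.verts, x ∉ B → x ∈ A) :
    Q.first ∈ P.first :: (drops A B P.verts).map Prod.snd := by
  obtain ⟨p, t, he⟩ := h.1
  have hq : Q.verts = Q.first :: Q.verts.tail := (List.cons_head_tail Q.ne).symm
  have hA : Q.first ∈ B := h.2.1 (show Q.first ∈ Q.verts from List.head_mem Q.ne)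
  rcases List.eq_nil_or_concat p with rfl | ⟨p, b, rfl⟩
  · have : P.first = Q.first := by
      unfold Dpath.first
      have hne := Q.ne
      simp only [List.nil_append] at he
      simp only [← he]
      rw [List.head_append_of_ne_nil hne]
    simp [this]
  · have he' : P.verts = p ++ b :: Q.verts ++ t := by rw [← he]; simp
    have hb := seg_prev h he'
    have hb' := hP b (by rw [he']; simp) hb
    refine List.mem_cons_of_mem _ (List.mem_map.2 ⟨(b, Q.first), ?_, rfl⟩)
    have := mem_zip_tail b Q.first (Q.verts.tail ++ t) p
    have e : p ++ b :: Q.first :: (Q.verts.tail ++ t) = P.verts := by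
      rw [he']
      conv_rhs => rw [hq]
      simp
    rw [e] at this
    simp only [drops, List.mem_filter, decide_eq_true_eq]
    exact ⟨this, hb', hA⟩

theorem split_uniq {V : Type} {p q s t : List V} {x : V} (hn : (p ++ x :: s).Nodup)
    (he : p ++ x :: s = q ++ x :: t) : p = q ∧ s = t := by
  have h1 : x ∉ p := by
    intro h; rw [List.nodup_append] at hn; exact hn.2.2 x h x (by simp) rfl
  have h2 : x ∉ q := by
    intro h; rw [he, List.nodup_append] at hn; exact hn.2.2 x h x (by simp) rfl
  induction p generalizing q with
  | nil =>
    cases q with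
    | nil => simpa using he
    | cons a q => simp at he; simp [he.1] at h2
  | cons a p ih =>
    cases q with
    | nil => simp at he; simp [he.1] at h1
    | cons b q =>
      simp only [List.cons_append, List.cons.injEq] at he
      have := ih (by simp at hn; exact hn.2) he.2 (by simp at h1; exact h1.2) (by simp at h2; exact h2.2)
      simp [he.1, this]

theorem seg_eq_of_last {V : Type} {G : Dgraph V} {P Q R : Dpath G} {S : Set V} (h : IsSeg P S Q)
    (h' : IsSeg P S R) (hl : Q.last = R.last) : Q.verts = R.verts := by
  obtain ⟨p, t, he⟩ := h.1
  obtain ⟨p', t', he'⟩ := h'.1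
  have hq : Q.verts = Q.verts.dropLast ++ [Q.last] := (List.dropLast_append_getLast Q.ne).symm
  have hr : R.verts = R.verts.dropLast ++ [R.last] := (List.dropLast_append_getLast R.ne).symm
  have e1 : P.verts = (p ++ Q.verts.dropLast) ++ Q.last :: t := by
    rw [← he]; conv_lhs => rw [hq]
    simp
  have e2 : P.verts = (p' ++ R.verts.dropLast) ++ Q.last :: t' := by
    rw [← he', hl]; conv_lhs => rw [hr]
    simp
  have := split_uniq (by rw [← e1]; exact P.nodup) (e1.symm.trans e2)
  have e3 : p ++ Q.verts = p' ++ R.verts := by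
    rw [hq, hr, ← List.append_assoc, this.1, hl]; simp
  rcases List.suffix_or_suffix_of_suffix (show Q.verts <:+ p ++ Q.verts from ⟨p, rfl⟩)
    (show R.verts <:+ p ++ Q.verts from ⟨p', e3.symm⟩) with hs | hs
  · exact (h.2.2 R h'.1 h'.2.1 hs.isInfix).symm
  · exact h'.2.2 Q h.1 h.2.1 hs.isInfix

theorem seg_eq_of_first {V : Type} {G : Dgraph V} {P Q R : Dpath G} {S : Set V} (h : IsSeg P S Q)
    (h' : IsSeg P S R) (hl : Q.first = R.first) : Q.verts = R.verts := by
  obtain ⟨p, t, he⟩ := h.1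
  obtain ⟨p', t', he'⟩ := h'.1
  have hq : Q.verts = Q.first :: Q.verts.tail := (List.cons_head_tail Q.ne).symm
  have hr : R.verts = R.first :: R.verts.tail := (List.cons_head_tail R.ne).symm
  have e1 : P.verts = p ++ Q.first :: (Q.verts.tail ++ t) := by
    rw [← he]; conv_lhs => rw [hq]
    simp
  have e2 : P.verts = p' ++ Q.first :: (R.verts.tail ++ t') := by
    rw [← he', hl]; conv_lhs => rw [hr]
    simp
  have := split_uniq (by rw [← e1]; exact P.nodup) (e1.symm.trans e2)
  have e3 : Q.verts ++ t = R.verts ++ t' := by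
    rw [hq, hr, List.cons_append, this.2, hl]; simp
  rcases List.prefix_or_prefix_of_prefix (show Q.verts <+: Q.verts ++ t from ⟨t, rfl⟩)
    (show R.verts <+: Q.verts ++ t from ⟨t', e3.symm⟩) with hs | hs
  · exact (h.2.2 R h'.1 h'.2.1 hs.isInfix).symm
  · exact h'.2.2 Q h.1 h.2.1 hs.isInfix

theorem few_lists {V : Type} {G : Dgraph V} {w : ℕ} (p : Dpath G → Prop) (key : Dpath G → V)
    (l : List V) (hl : l.length ≤ w) (h1 : ∀ Q, p Q → key Q ∈ l)
    (h2 : ∀ Q R, p Q → p R → key Q = key R → Q.verts = R.verts) :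
    ∃ F : Finset (List V), F.card ≤ w ∧ ∀ Q, p Q → Q.verts ∈ F := by
  classical
  let f : V → List V := fun x => if h : ∃ Q, p Q ∧ key Q = x then (Classical.choose h).verts else []
  refine ⟨(l.map f).toFinset, (List.toFinset_card_le _).trans (by simpa using hl), ?_⟩
  intro Q hQ
  rw [List.mem_toFinset, List.mem_map]
  refine ⟨key Q, h1 Q hQ, ?_⟩
  have h : ∃ Q', p Q' ∧ key Q' = key Q := ⟨Q, hQ, rfl⟩
  have hs := Classical.choose_spec h
  simp only [f, dif_pos h]
  exact h2 _ _ hs.1 hQ hs.2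

theorem few_A {V : Type} {G : Dgraph V} {w : ℕ} {P : Dpath G} {A B : Set V}
    (hAB : ∀ x ∈ A, x ∉ B) (hP : ∀ x ∈ P.verts, x ∉ A → x ∈ B) (hw : wiggle P A B ≤ w) :
    ∃ F : Finset (List V), F.card ≤ w + 1 ∧ ∀ Q, IsSeg P A Q → Q.verts ∈ F := by
  refine few_lists _ Dpath.last (P.last :: (drops A B P.verts).map Prod.fst) ?_
    (fun Q hQ => seg_last_mem hQ hP) (fun Q R hQ hR => seg_eq_of_last hQ hR)
  simpa using (drops_le hAB P).trans hw

theorem few_B {V : Type} {G : Dgraph V} {w : ℕ} {P : Dpath G} {A B : Set V}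
    (hAB : ∀ x ∈ A, x ∉ B) (hP : ∀ x ∈ P.verts, x ∉ B → x ∈ A) (hw : wiggle P A B ≤ w) :
    ∃ F : Finset (List V), F.card ≤ w + 1 ∧ ∀ Q, IsSeg P B Q → Q.verts ∈ F := by
  refine few_lists _ Dpath.first (P.first :: (drops A B P.verts).map Prod.snd) ?_
    (fun Q hQ => seg_first_mem hQ hP) (fun Q R hQ hR => seg_eq_of_first hQ hR)
  simpa using (drops_le hAB P).trans hw

theorem count {V : Type} {c k w K : ℕ} (hK : 1 ≤ K) (T : Finset V) (fa : V → Fin c)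
    (fi fj : V → Fin k) (fy : V → List V) (Ys : Fin c → Fin k → Finset (List V))
    (hYs : ∀ a j, (Ys a j).card ≤ w + 1) (hy : ∀ v ∈ T, fy v ∈ Ys (fa v) (fj v))
    (H2 : ∀ v ∈ T, fi v ≠ fj v)
    (H1 : ∀ a i j y, (T.filter fun v => fa v = a ∧ fi v = i ∧ fj v = j ∧ fy v = y).card ≤ K)
    (H3 : ∀ a i j y y', i ≠ j →
      2 ≤ (T.filter fun v => fa v = a ∧ fi v = i ∧ fj v = j ∧ fy v = y).card →
      2 ≤ (T.filter fun v => fa v = a ∧ fi v = j ∧ fj v = i ∧ fy v = y').card → False) :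
    2 * T.card ≤ c * (k * k - k) * ((w + 1) * (K + 1)) := by
  classical
  set g : Fin c → Fin k → Fin k → ℕ := fun a i j =>
    (T.filter fun v => fa v = a ∧ fi v = i ∧ fj v = j).card with hg
  have hgs : ∀ a i j, g a i j = ∑ y ∈ Ys a j,
      (T.filter fun v => fa v = a ∧ fi v = i ∧ fj v = j ∧ fy v = y).card := by
    intro a i j
    rw [hg]
    simp only
    rw [Finset.card_eq_sum_card_fiberwise (f := fy) (t := Ys a j)]
    · refine Finset.sum_congr rfl fun y _ => ?_
      rw [Finset.filter_filter]
      congr 1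
      ext v
      simp only [Finset.mem_filter]
      tauto
    · intro v hv
      simp only [Finset.coe_filter, Set.mem_setOf_eq] at hv
      have := hy v hv.1
      rw [hv.2.1, hv.2.2.2] at this
      exact this
  have hgb : ∀ a i j M, (∀ y, (T.filter fun v => fa v = a ∧ fi v = i ∧ fj v = j ∧ fy v = y).card ≤ M)
      → g a i j ≤ (w + 1) * M := by
    intro a i j M hM
    rw [hgs]
    refine (Finset.sum_le_card_nsmul _ _ M fun y _ => hM y).trans ?_
    rw [smul_eq_mul]
    exact Nat.mul_le_mul_right _ (hYs a j)
  have hpair : ∀ a i j, i ≠ j → g a i j + g a j i ≤ (w + 1) * (K + 1) := by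
    intro a i j hij
    by_cases h : ∀ y, (T.filter fun v => fa v = a ∧ fi v = i ∧ fj v = j ∧ fy v = y).card ≤ 1
    · have h1 := hgb a i j 1 h
      have h2 := hgb a j i K (H1 a j i)
      rw [Nat.mul_add]; omega
    · push Not at h
      obtain ⟨y, hy'⟩ := h
      have h1 := hgb a i j K (H1 a i j)
      have h2 := hgb a j i 1 (fun y' => by
        by_contra hcon
        exact H3 a i j y y' hij hy' (by omega))
      rw [Nat.mul_add]; omega
  have hT : T.card = ∑ a : Fin c, ∑ p ∈ (Finset.univ : Finset (Fin k)).offDiag, g a p.1 p.2 := by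
    rw [← Finset.sum_product', Finset.card_eq_sum_card_fiberwise
      (f := fun v => (fa v, (fi v, fj v)))
      (t := (Finset.univ : Finset (Fin c)) ×ˢ (Finset.univ : Finset (Fin k)).offDiag)]
    · refine Finset.sum_congr rfl fun p _ => ?_
      rw [hg]
      simp only
      congr 1
      ext v
      simp [Prod.ext_iff]
    · intro v hv
      simpa using H2 v hv
  have hsw : ∀ a, ∑ p ∈ (Finset.univ : Finset (Fin k)).offDiag, g a p.1 p.2 =
      ∑ p ∈ (Finset.univ : Finset (Fin k)).offDiag, g a p.2 p.1 := by
    intro a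
    refine Finset.sum_nbij' Prod.swap Prod.swap ?_ ?_ ?_ ?_ ?_ <;> simp <;> tauto
  have hone : ∀ a, 2 * ∑ p ∈ (Finset.univ : Finset (Fin k)).offDiag, g a p.1 p.2 ≤
      (k * k - k) * ((w + 1) * (K + 1)) := by
    intro a
    rw [two_mul]
    nth_rewrite 2 [hsw a]
    rw [← Finset.sum_add_distrib]
    refine (Finset.sum_le_card_nsmul _ _ ((w + 1) * (K + 1)) fun p hp => ?_).trans ?_
    · exact hpair a p.1 p.2 (by simpa using hp)
    · simp [Finset.offDiag_card]
  rw [hT, Finset.mul_sum]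
  refine (Finset.sum_le_card_nsmul _ _ _ fun a _ => hone a).trans ?_
  simp [mul_assoc]

/-- data attached to a vertex outside `A` -/
def QB {V : Type} {G : Dgraph V} {k c : ℕ} (L : Fin k → Dpath G) (C : Fin c → Set V) (B : Set V)
    (a : Fin c) (i j : Fin k) (Y : List V) (v : V) : Prop :=
  Y.length = k ^ 2 + k + 2 ∧ Y.Sublist (L j).verts ∧ (∀ y ∈ Y, y ∈ C a \ (B ∩ C a)) ∧
  (∀ y ∈ Y, G.adj v y) ∧
  ((v ∈ (L i).verts ∧ v ∈ B ∩ C a) ∨ (v ∉ linkSupport L ∧ ∃ X : List V, X.length = k ^ 2 + k + 2 ∧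
    X.Sublist (L i).verts ∧ ∀ u ∈ X, u ∈ B ∩ C a ∧ G.adj u v))

/-- data attached to a vertex of `A` -/
def QA {V : Type} {G : Dgraph V} {k c : ℕ} (L : Fin k → Dpath G) (C : Fin c → Set V) (B : Set V)
    (a : Fin c) (i j : Fin k) (X : List V) (v : V) : Prop :=
  X.length = k ^ 2 + k + 2 ∧ X.Sublist (L i).verts ∧ (∀ x ∈ X, x ∈ B ∩ C a) ∧
  (∀ x ∈ X, G.adj x v) ∧ v ∈ (L j).verts ∧ v ∈ C a \ (B ∩ C a)

theorem three_le {k : ℕ} {i j : Fin k} (h : i ≠ j) : 3 ≤ k ^ 2 + k := by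
  have : 2 ≤ k := by
    have := i.isLt; have := j.isLt
    have : (i : ℕ) ≠ j := fun h' => h (Fin.ext h')
    omega
  nlinarith

theorem boundB {V : Type} {G : Dgraph V} {k c w : ℕ} (hk : 1 ≤ k) {L : Fin k → Dpath G}
    (hL : IsMinimumLinkage L) {sv tv : Fin k → V} {C : Fin c → Set V} (hC : ∀ a, G.IsClique (C a))
    {B : Set V} (hacc : ∀ a, CAcceptable sv tv L (C a) (B ∩ C a))
    (T : Finset V) (fa : V → Fin c)
    (fi fj : V → Fin k) (fy : V → List V) (Ys : Fin c → Fin k → Finset (List V))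
    (hYs : ∀ a j, (Ys a j).card ≤ w + 1) (hy : ∀ v ∈ T, fy v ∈ Ys (fa v) (fj v))
    (hQ : ∀ v ∈ T, QB L C B (fa v) (fi v) (fj v) (fy v) v) :
    2 * T.card ≤ c * (k * k - k) * ((w + 1) * (k ^ 2 + k + 1 + 1)) := by
  have key : ∀ a i j y, ∀ v ∈ (T.filter fun v => fa v = a ∧ fi v = i ∧ fj v = j ∧ fy v = y),
      QB L C B a i j y v := by
    intro a i j y v hv
    rw [Finset.mem_filter] at hv
    obtain ⟨h1, rfl, rfl, rfl, rfl⟩ := hv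
    exact hQ v h1
  have fib : ∀ a i j y, FibB L (k ^ 2 + k + 2) i (B ∩ C a) y
      (T.filter fun v => fa v = a ∧ fi v = i ∧ fj v = j ∧ fy v = y) := fun a i j y =>
    ⟨fun v hv => (key a i j y v hv).2.2.2.2, fun v hv => (key a i j y v hv).2.2.2.1⟩
  refine count (by omega) T fa fi fj fy Ys hYs hy ?_ ?_ ?_
  · intro v hv he
    obtain ⟨h1, h2, h3, h4, h5⟩ := hQ v hv
    rw [← he] at h2
    refine fibB_diag hL (hacc (fa v)) h1 h2 h3 (by omega) (i := fi v) (v := v) ⟨?_, ?_⟩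
    · intro u hu; rw [Finset.mem_singleton] at hu; subst hu; exact h5
    · intro u hu; rw [Finset.mem_singleton] at hu; subst hu; exact h4
  · intro a i j y
    rcases Finset.eq_empty_or_nonempty
      (T.filter fun v => fa v = a ∧ fi v = i ∧ fj v = j ∧ fy v = y) with h | ⟨v, hv⟩
    · rw [h]; simp
    · obtain ⟨h1, h2, h3, -, -⟩ := key a i j y v hv
      exact fibB_card (hacc a) h1 h2 h3 (fib a i j y)
  · intro a i j y y' hij c1 c2
    obtain ⟨v, hv⟩ := Finset.card_pos.1 (show 0 < _ by omega : 0 < (T.filter fun v => fa v = a ∧ fi v = i ∧ fj v = j ∧ fy v = y).card)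
    obtain ⟨v', hv'⟩ := Finset.card_pos.1 (show 0 < _ by omega : 0 < (T.filter fun v => fa v = a ∧ fi v = j ∧ fj v = i ∧ fy v = y').card)
    obtain ⟨h1, h2, h3, -, -⟩ := key a i j y v hv
    obtain ⟨h1', h2', h3', -, -⟩ := key a j i y' v' hv'
    refine fibB_swap hL (hC a) (hacc a) hij (three_le hij) h1 h2 h3 h1' h2' h3'
      (fib a i j y) (fib a j i y') ?_ c1 c2
    intro u hu hu'
    rw [Finset.mem_filter] at hu hu'
    exact hij (hu.2.2.1.symm.trans hu'.2.2.1)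

theorem boundA {V : Type} {G : Dgraph V} {k c w : ℕ} {L : Fin k → Dpath G}
    (hL : IsMinimumLinkage L) {sv tv : Fin k → V} {C : Fin c → Set V} (hC : ∀ a, G.IsClique (C a))
    {B : Set V} (hacc : ∀ a, CAcceptable sv tv L (C a) (B ∩ C a))
    (T : Finset V) (fa : V → Fin c)
    (fi fj : V → Fin k) (fy : V → List V) (Xs : Fin c → Fin k → Finset (List V))
    (hXs : ∀ a i, (Xs a i).card ≤ w + 1) (hx : ∀ v ∈ T, fy v ∈ Xs (fa v) (fi v))
    (hQ : ∀ v ∈ T, QA L C B (fa v) (fi v) (fj v) (fy v) v) :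
    2 * T.card ≤ c * (k * k - k) * ((w + 1) * (k ^ 2 + k + 1 + 1)) := by
  have key : ∀ a j i y, ∀ v ∈ (T.filter fun v => fa v = a ∧ fj v = j ∧ fi v = i ∧ fy v = y),
      QA L C B a i j y v := by
    intro a j i y v hv
    rw [Finset.mem_filter] at hv
    obtain ⟨h1, rfl, rfl, rfl, rfl⟩ := hv
    exact hQ v h1
  have fib : ∀ a j i y, FibA L j (C a \ (B ∩ C a)) y
      (T.filter fun v => fa v = a ∧ fj v = j ∧ fi v = i ∧ fy v = y) := fun a j i y v hv =>
    ⟨(key a j i y v hv).2.2.2.2.1, (key a j i y v hv).2.2.2.2.2, (key a j i y v hv).2.2.2.1⟩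
  refine count (by omega) T fa fj fi fy Xs hXs hx ?_ ?_ ?_
  · intro v hv he
    obtain ⟨h1, h2, h3, h4, h5, h6⟩ := hQ v hv
    rw [← he] at h2
    refine fibA_diag hL (hacc (fa v)) h1 h2 h3 (v := v) ?_
    intro u hu; rw [Finset.mem_singleton] at hu; subst hu; exact ⟨h5, h6, h4⟩
  · intro a j i y
    rcases Finset.eq_empty_or_nonempty
      (T.filter fun v => fa v = a ∧ fj v = j ∧ fi v = i ∧ fy v = y) with h | ⟨v, hv⟩
    · rw [h]; simp
    · obtain ⟨h1, h2, h3, -, -⟩ := key a j i y v hv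
      exact fibA_card (hacc a) h1 h2 h3 (fib a j i y)
  · intro a j i y y' hij c1 c2
    obtain ⟨v, hv⟩ := Finset.card_pos.1 (show 0 < _ by omega : 0 < (T.filter fun v => fa v = a ∧ fj v = j ∧ fi v = i ∧ fy v = y).card)
    obtain ⟨v', hv'⟩ := Finset.card_pos.1 (show 0 < _ by omega : 0 < (T.filter fun v => fa v = a ∧ fj v = i ∧ fi v = j ∧ fy v = y').card)
    obtain ⟨h1, h2, h3, -, -⟩ := key a j i y v hv
    obtain ⟨h1', h2', h3', -, -⟩ := key a i j y' v' hv'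
    exact fibA_swap hL (hC a) (hacc a) hij.symm (three_le hij) h1 h2 h3 h1' h2' h3'
      (fib a j i y) (fib a i j y') c1 c2

/-- the list of first vertices used for `A`-segments -/
noncomputable def yOf {V : Type} (k : ℕ) (C : Set V) (l : List V) : List V :=
  ((inOrderIn l C).take (k ^ 2 + k + 3)).take (k ^ 2 + k + 2)

/-- the list of last vertices used for `B`-segments -/
noncomputable def xOf {V : Type} (k : ℕ) (C : Set V) (l : List V) : List V :=
  ((inOrderIn l C).drop ((inOrderIn l C).length - (k ^ 2 + k + 3))).drop 1

theorem minus_extract {V : Type} {G : Dgraph V} {k c : ℕ} {L : Fin k → Dpath G} {sv : Fin k → V}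
    {C : Fin c → Set V} (hpart : G.IsCliquePartition C) {e : List V} {h : ℕ} {v : V}
    (hv : v ∈ minusSet G C (k ^ 2 + k + 3) (AseqsOf G C (k ^ 2 + k + 3) L sv e h))
    (hvA : v ∉ AsetOf L sv e h) :
    ∃ a j R, v ∈ C a ∧ IsSeg (L j) (AsetOf L sv e h) R ∧
      (yOf k (C a) R.verts).length = k ^ 2 + k + 2 ∧
      (yOf k (C a) R.verts).Sublist (L j).verts ∧
      (∀ y ∈ yOf k (C a) R.verts, y ∈ C a \ (BsetOf sv e h ∩ C a)) ∧
      ∀ y ∈ yOf k (C a) R.verts, G.adj v y := by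
  obtain ⟨X, ⟨R, ⟨j, hR⟩, b, rfl⟩, a, hsub, hcase⟩ := hv
  have hsl : (firstUpTo R (C b) (k ^ 2 + k + 3)).Sublist R.verts :=
    (List.take_sublist _ _).trans List.filter_sublist
  have hXA : ∀ x ∈ firstUpTo R (C b) (k ^ 2 + k + 3), x ∈ AsetOf L sv e h := fun x hx =>
    hR.2.1 (hsl.subset hx)
  rcases hcase with hin | ⟨hnin, hlen, hadj⟩
  · exact absurd (hXA v hin) hvA
  have hab : a = b := by
    obtain ⟨x, hx⟩ := List.exists_mem_of_length_pos (by omega : 0 < (firstUpTo R (C b) (k ^ 2 + k + 3)).length)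
    have hb : x ∈ C b := by
      have := (List.take_sublist _ _).subset hx
      simpa [inOrderIn] using (List.mem_filter.1 this).2
    have ha : x ∈ C a := hsub (Set.mem_insert_of_mem _ hx)
    exact (hpart.2 x).unique ha hb
  subst hab
  have hyX : (yOf k (C a) R.verts).Sublist (firstUpTo R (C a) (k ^ 2 + k + 3)) :=
    List.take_sublist _ _
  refine ⟨a, j, R, hsub (Set.mem_insert _ _), hR, ?_, ?_, ?_, ?_⟩
  · have : yOf k (C a) R.verts = (firstUpTo R (C a) (k ^ 2 + k + 3)).take (k ^ 2 + k + 2) := rfl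
    rw [this, List.length_take, hlen]; omega
  · exact (hyX.trans hsl).trans hR.1.sublist
  · intro y hy
    exact ⟨hsub (Set.mem_insert_of_mem _ (hyX.subset hy)), fun h' => (hXA y (hyX.subset hy)).2 h'.1⟩
  · intro y hy
    exact hadj y hy

theorem plus_extract {V : Type} {G : Dgraph V} {k c : ℕ} {L : Fin k → Dpath G} {sv : Fin k → V}
    {C : Fin c → Set V} (hpart : G.IsCliquePartition C) {e : List V} {h : ℕ} {v : V}
    (hv : v ∈ plusSet G C (k ^ 2 + k + 3) (BseqsOf G C (k ^ 2 + k + 3) L sv e h))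
    (hvB : v ∉ BsetOf sv e h) :
    ∃ a i Q, v ∈ C a ∧ IsSeg (L i) (BsetOf sv e h) Q ∧
      (xOf k (C a) Q.verts).length = k ^ 2 + k + 2 ∧
      (xOf k (C a) Q.verts).Sublist (L i).verts ∧
      (∀ x ∈ xOf k (C a) Q.verts, x ∈ BsetOf sv e h ∩ C a) ∧
      ∀ x ∈ xOf k (C a) Q.verts, G.adj x v := by
  obtain ⟨X, ⟨R, ⟨j, hR⟩, b, rfl⟩, a, hsub, hcase⟩ := hv
  have hsl : (lastIn R (C b) (k ^ 2 + k + 3)).Sublist R.verts :=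
    (List.drop_sublist _ _).trans List.filter_sublist
  have hXB : ∀ x ∈ lastIn R (C b) (k ^ 2 + k + 3), x ∈ BsetOf sv e h := fun x hx =>
    hR.2.1 (hsl.subset hx)
  rcases hcase with hin | ⟨hnin, hlen, hadj⟩
  · exact absurd (hXB v hin) hvB
  have hab : a = b := by
    obtain ⟨x, hx⟩ := List.exists_mem_of_length_pos (by omega : 0 < (lastIn R (C b) (k ^ 2 + k + 3)).length)
    have hb : x ∈ C b := by
      have := (List.drop_sublist _ _).subset hx
      simpa [inOrderIn] using (List.mem_filter.1 this).2
    have ha : x ∈ C a := hsub (Set.mem_insert_of_mem _ hx)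
    exact (hpart.2 x).unique ha hb
  subst hab
  have hyX : (xOf k (C a) R.verts).Sublist (lastIn R (C a) (k ^ 2 + k + 3)) :=
    List.drop_sublist _ _
  have hdef : xOf k (C a) R.verts = (lastIn R (C a) (k ^ 2 + k + 3)).drop 1 := rfl
  refine ⟨a, j, R, hsub (Set.mem_insert _ _), hR, ?_, ?_, ?_, ?_⟩
  · rw [hdef, List.length_drop, hlen]; omega
  · exact (hyX.trans hsl).trans hR.1.sublist
  · intro y hy
    exact ⟨hXB y (hyX.subset hy), hsub (Set.mem_insert_of_mem _ (hyX.subset hy))⟩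
  · intro y hy
    refine hadj y ?_
    rw [hlen, show k ^ 2 + k + 3 - (k ^ 2 + k + 3 - 1) = 1 by omega, ← hdef]
    exact hy

theorem main {V : Type} [Fintype V] {k c : ℕ} (hk : 1 ≤ k)
    (G : Dgraph V) (sv tv : Fin k → V)
    (C : Fin c → Set V) (hpart : G.IsCliquePartition C)
    (L : Fin k → Dpath G) (hL : IsMinimumLinkageFor L sv tv)
    (e : List V) (henum : IsEnumeration L sv tv e)
    (w : ℕ) (h : ℕ)
    (hacc : ∀ a, CAcceptable sv tv L (C a) (BsetOf sv e h ∩ C a))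
    (hwig : ∀ i, wiggle (L i) (AsetOf L sv e h) (BsetOf sv e h) ≤ w) :
    (plusSet G C (k ^ 2 + k + 3) (BseqsOf G C (k ^ 2 + k + 3) L sv e h) ∩
        minusSet G C (k ^ 2 + k + 3) (AseqsOf G C (k ^ 2 + k + 3) L sv e h)).ncard ≤
      2 * c * (k ^ 2 + k + 3) * k * w + c * (2 * w + 1) * k ^ 2 * (k ^ 2 + k + 1) := by
  classical
  have : Nonempty (Fin k) := ⟨⟨0, hk⟩⟩
  set A := AsetOf L sv e h with hA
  set B := BsetOf sv e h with hB
  set S := plusSet G C (k ^ 2 + k + 3) (BseqsOf G C (k ^ 2 + k + 3) L sv e h) ∩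
        minusSet G C (k ^ 2 + k + 3) (AseqsOf G C (k ^ 2 + k + 3) L sv e h) with hS
  have hAB : ∀ x ∈ A, x ∉ B := fun x hx => hx.2
  have hlink : ∀ i, ∀ x ∈ (L i).verts, x ∈ linkSupport L := fun i x hx => Set.mem_iUnion.2 ⟨i, hx⟩
  have hP1 : ∀ i, ∀ x ∈ (L i).verts, x ∉ A → x ∈ B := by
    intro i x hx hxA
    by_contra hxB
    exact hxA ⟨hlink i x hx, hxB⟩
  have hP2 : ∀ i, ∀ x ∈ (L i).verts, x ∉ B → x ∈ A := fun i x hx hxB => ⟨hlink i x hx, hxB⟩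
  have hBL : ∀ x ∈ B, ∃ i, x ∈ (L i).verts := by
    intro x hx
    rcases hx with ⟨i, rfl⟩ | hx
    · refine ⟨i, ?_⟩
      rw [← (hL.1.2 i).1]
      exact List.head_mem _
    · have hx' : x ∈ {v | v ∈ e} := (List.take_sublist _ _).subset hx
      rw [henum.2] at hx'
      exact Set.mem_iUnion.1 hx'.1
  choose FA hFA hFA' using fun i => few_A (w := w) hAB (hP1 i) (hwig i)
  choose FB hFB hFB' using fun i => few_B (w := w) hAB (hP2 i) (hwig i)
  have hSA : ∀ v, v ∈ S.toFinset.filter (fun v => v ∉ A) → ∃ a : Fin c, ∃ i j : Fin k, ∃ Y : List V,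
      Y ∈ (FA j).image (yOf k (C a)) ∧ QB L C B a i j Y v := by
    intro v hv
    rw [Finset.mem_filter, Set.mem_toFinset] at hv
    obtain ⟨a, j, R, h1, h2, h3, h4, h5, h6⟩ := minus_extract hpart hv.1.2 hv.2
    by_cases hvB : v ∈ B
    · obtain ⟨i, hi⟩ := hBL v hvB
      exact ⟨a, i, j, _, Finset.mem_image_of_mem _ (hFA' j R h2), h3, h4, h5, h6,
        Or.inl ⟨hi, hvB, h1⟩⟩
    · obtain ⟨a', i, Q, g1, g2, g3, g4, g5, g6⟩ := plus_extract hpart hv.1.1 hvB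
      have haa : a' = a := (hpart.2 v).unique g1 h1
      subst haa
      exact ⟨a', i, j, _, Finset.mem_image_of_mem _ (hFA' j R h2), h3, h4, h5, h6,
        Or.inr ⟨fun hl => hv.2 ⟨hl, hvB⟩, _, g3, g4, fun u hu => ⟨g5 u hu, g6 u hu⟩⟩⟩
  have hSB : ∀ v, v ∈ S.toFinset.filter (fun v => ¬ v ∉ A) → ∃ a : Fin c, ∃ i j : Fin k, ∃ X : List V,
      X ∈ (FB i).image (xOf k (C a)) ∧ QA L C B a i j X v := by
    intro v hv
    rw [Finset.mem_filter, Set.mem_toFinset, not_not] at hv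
    obtain ⟨a, i, Q, g1, g2, g3, g4, g5, g6⟩ := plus_extract hpart hv.1.1 hv.2.2
    obtain ⟨j, hj⟩ := Set.mem_iUnion.1 hv.2.1
    exact ⟨a, i, j, _, Finset.mem_image_of_mem _ (hFB' i Q g2), g3, g4, g5, g6, hj, g1,
      fun h' => hv.2.2 h'.1⟩
  have hcard : S.ncard = (S.toFinset.filter (fun v => v ∉ A)).card +
      (S.toFinset.filter (fun v => ¬ v ∉ A)).card := by
    rw [Finset.card_filter_add_card_filter_not, Set.ncard_eq_toFinset_card']
  rcases Nat.eq_zero_or_pos c with rfl | hc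
  · have : S = ∅ := by
      ext v
      obtain ⟨a, -⟩ := hpart.2 v
      exact a.elim0
    rw [this]; simp
  have : Nonempty (Fin c) := ⟨⟨0, hc⟩⟩
  choose! fa fi fj fy hy1 hy2 using hSA
  choose! ga gi gj gx hx1 hx2 using hSB
  have b1 := boundB (w := w) hk hL.2 hpart.1 hacc _ fa fi fj fy (fun a j => (FA j).image (yOf k (C a)))
    (fun a j => Finset.card_image_le.trans (hFA j)) hy1 hy2
  have b2 := boundA (w := w) hL.2 hpart.1 hacc _ ga gi gj gx (fun a i => (FB i).image (xOf k (C a)))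
    (fun a i => Finset.card_image_le.trans (hFB i)) hx1 hx2
  have hfin : c * (k * k - k) * ((w + 1) * (k ^ 2 + k + 1 + 1)) ≤
      c * (2 * w + 1) * k ^ 2 * (k ^ 2 + k + 1) := by
    have h1 : (k * k - k) * (k ^ 2 + k + 1 + 1) ≤ k ^ 2 * (k ^ 2 + k + 1) := by
      obtain ⟨m, rfl⟩ : ∃ m, k = m + 1 := ⟨k - 1, by omega⟩
      have : (m + 1) * (m + 1) - (m + 1) = (m + 1) * m := by
        rw [Nat.sub_eq_iff_eq_add (by nlinarith)]; ring
      rw [this]; nlinarith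
    calc c * (k * k - k) * ((w + 1) * (k ^ 2 + k + 1 + 1))
        = c * (w + 1) * ((k * k - k) * (k ^ 2 + k + 1 + 1)) := by ring
      _ ≤ c * (2 * w + 1) * (k ^ 2 * (k ^ 2 + k + 1)) :=
          Nat.mul_le_mul (Nat.mul_le_mul_left _ (by omega)) h1
      _ = _ := by ring
  have : S.ncard ≤ c * (2 * w + 1) * k ^ 2 * (k ^ 2 + k + 1) := by omega
  exact this.trans (Nat.le_add_left _ _)

end PIM

/-- Step (1) of the proof of Theorem 4.2: `|ℬ h⁺ ∩ 𝒜 h⁻| ≤ 2cskw + c(2w+1)k²(k²+k+1)`. -/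
theorem plus_inter_minus_bound {V : Type} [Fintype V] {k c : ℕ} (hk : 1 ≤ k) (hc : 1 ≤ c)
    (G : Dgraph V) (sv tv : Fin k → V) (hinst : IsInstance sv tv)
    (C : Fin c → Set V) (hpart : G.IsCliquePartition C)
    (L : Fin k → Dpath G) (hL : IsMinimumLinkageFor L sv tv)
    (e : List V) (henum : IsEnumeration L sv tv e)
    (w : ℕ) (h : ℕ) (hh : h ≤ e.length)
    (hacc : ∀ a, CAcceptable sv tv L (C a) (BsetOf sv e h ∩ C a))
    (hwig : ∀ i, wiggle (L i) (AsetOf L sv e h) (BsetOf sv e h) ≤ w) :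
    (plusSet G C (k ^ 2 + k + 3) (BseqsOf G C (k ^ 2 + k + 3) L sv e h) ∩
        minusSet G C (k ^ 2 + k + 3) (AseqsOf G C (k ^ 2 + k + 3) L sv e h)).ncard ≤
      2 * c * (k ^ 2 + k + 3) * k * w + c * (2 * w + 1) * k ^ 2 * (k ^ 2 + k + 1) := by
  exact PIM.main hk G sv tv C hpart L hL e henum w h hacc hwig
end

section
/- Let k,c≥1 and let z≥0 be an integer. Let (G,s_1,t_1,…,s_k,t_k) be a problem instance where G has a clique-partition (C_1,…,C_c), let L=(P_1,…,P_k) be a linkage for it, let B⊆V(L) and A=V(L)∖B. Suppose that B∩C_a is C_a-acceptable for L for each a∈{1,…,c}, and that for all distinct a,b∈{1,…,c} and all i∈{1,…,k}, the (B∩C_b, A∩C_a)-wiggle number of P_i is at most z. Then the (B,A)-wiggle number of each member of L is at most c(c−1)(z+1)+1. -/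
open scoped Classical

/-- Alternating sequences have bounded length. -/
theorem hasAlt_bddAbove {V : Type} {G : Dgraph V} (P : Dpath G) (X Y : Set V) :
    BddAbove {m | HasAlt P X Y m} := by
  refine ⟨P.verts.length, ?_⟩
  rintro m ⟨l, hl, hlen, -⟩
  have := hl.length_le
  omega

/-- In a duplicate-free list with a prefix `q`, a vertex preceding a member of `q` is in `q`. -/
theorem mem_prefix_of_pair {V : Type} {l q : List V} (hn : l.Nodup) (hq : q <+: l) {x y : V}
    (hxy : [x, y].Sublist l) (hy : y ∈ q) : x ∈ q := by
  obtain ⟨r, rfl⟩ := hq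
  rw [List.sublist_append_iff] at hxy
  obtain ⟨l1, l2, he, h1, h2⟩ := hxy
  have hd := (List.nodup_append'.1 hn).2.2
  rcases l1 with _ | ⟨u, l1⟩
  · simp only [List.nil_append] at he
    subst he
    exact absurd (h2.subset (by simp)) (hd hy)
  · simp only [List.cons_append, List.cons.injEq] at he
    rw [he.1]
    exact h1.subset (by simp)

/-- Selecting strictly increasing positions gives a sublist. -/
theorem ofFn_sublist {V : Type} (l : List V) (n : ℕ) (h : Fin n → ℕ) (hh : StrictMono h)
    (hlt : ∀ i, h i < l.length) : (List.ofFn fun i => l[h i]'(hlt i)).Sublist l := by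
  rw [List.sublist_iff_exists_fin_orderEmbedding_get_eq]
  refine ⟨OrderEmbedding.ofStrictMono
    (fun i => ⟨h (i.cast (by simp)), hlt _⟩) ?_, ?_⟩
  · intro i j hij
    exact hh (show (i.cast _ : Fin n) < j.cast _ from hij)
  · intro i
    simp
    rfl

/-- Final claim of the proof of Theorem 3.4: blockwise wiggle bounds give a global
`(B, A)`-wiggle bound of `c(c−1)(z+1)+1`, where `A = V(L) ∖ B`. -/
theorem global_wiggle_bound {V : Type} [Fintype V] {k c : ℕ} (hk : 1 ≤ k) (hc : 1 ≤ c)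
    (z : ℕ) (G : Dgraph V) (sv tv : Fin k → V) (hinst : IsInstance sv tv)
    (C : Fin c → Set V) (hpart : G.IsCliquePartition C)
    (L : Fin k → Dpath G) (hL : IsLinkageFor L sv tv)
    (B : Set V) (hBL : B ⊆ linkSupport L)
    (hacc : ∀ a, CAcceptable sv tv L (C a) (B ∩ C a))
    (hwig : ∀ a b, a ≠ b → ∀ i,
      wiggle (L i) (B ∩ C b) ((linkSupport L \ B) ∩ C a) ≤ z) :
    ∀ i, wiggle (L i) B (linkSupport L \ B) ≤ c * (c - 1) * (z + 1) + 1 := by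
  intro i
  have hcl := fun v => (hpart.2 v).exists
  choose cl hcl using hcl
  refine csSup_le (s := {m | HasAlt (L i) B (linkSupport L \ B) m})
    ⟨0, [], by simp, rfl, by intro i h; simp at h⟩ ?_
  rintro m ⟨l, hl, hlen, halt⟩
  by_contra! hm
  have hA : ∀ j (hj : 2 * j + 1 < l.length), l[2 * j + 1] ∈ linkSupport L \ B := by
    intro j hj
    have := halt (2 * j + 1) hj
    rwa [if_neg (by omega)] at this
  have hB : ∀ j (hj : 2 * j + 2 < l.length), l[2 * j + 2] ∈ B := by
    intro j hj
    have := halt (2 * j + 2) hj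
    rwa [if_pos (by omega)] at this
  have hne : ∀ j (hj : 2 * j + 2 < l.length), cl l[2 * j + 1] ≠ cl l[2 * j + 2] := by
    intro j hj heq
    obtain ⟨Q, hQ, hQC⟩ := (hacc (cl l[2 * j + 1])).2.2.2.1 i
    have hsub : [l[2 * j + 1], l[2 * j + 2]].Sublist (L i).verts := by
      refine List.Sublist.trans ?_ hl
      have := ofFn_sublist l 2 (fun p => 2 * j + 1 + p) (fun a b h => by simpa using h)
        (fun p => by have := p.2; omega)
      simpa using this
    have hy : l[2 * j + 2] ∈ Q.support ∩ C (cl l[2 * j + 1]) := by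
      rw [hQC]
      exact ⟨hsub.subset (by simp), hB j hj, heq ▸ hcl _⟩
    have hx : l[2 * j + 1] ∈ Q.support ∩ C (cl l[2 * j + 1]) :=
      ⟨mem_prefix_of_pair (L i).nodup hQ hsub hy.1, hcl _⟩
    rw [hQC] at hx
    exact (hA j (by omega)).2 hx.2.1
  let f : ℕ → Fin c × Fin c := fun j =>
    if hj : 2 * j + 2 < l.length then (cl l[2 * j + 1], cl l[2 * j + 2])
    else (⟨0, hc⟩, ⟨0, hc⟩)
  have hf : ∀ j ∈ Finset.range (m - 1), f j ∈ (Finset.univ : Finset (Fin c)).offDiag := by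
    intro j hj
    rw [Finset.mem_range] at hj
    have hj' : 2 * j + 2 < l.length := by omega
    simp only [f, dif_pos hj', Finset.mem_offDiag, Finset.mem_univ, true_and]
    exact hne j hj'
  have hcard : (Finset.univ : Finset (Fin c)).offDiag.card * (z + 1)
      < (Finset.range (m - 1)).card := by
    rw [Finset.offDiag_card, Finset.card_range, Finset.card_univ, Fintype.card_fin,
      ← Nat.mul_sub_one]
    omega
  obtain ⟨⟨a, b⟩, hab, hS⟩ := Finset.exists_lt_card_fiber_of_mul_lt_card_of_maps_to hf hcard
  have hab' : a ≠ b := by simpa using hab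
  obtain ⟨S, hSs, hSc⟩ := Finset.exists_subset_card_eq (show z + 2 ≤ _ from hS)
  let g := S.orderEmbOfFin hSc
  have hg : ∀ p, 2 * g p + 2 < l.length ∧ f (g p) = (a, b) := by
    intro p
    have := hSs (S.orderEmbOfFin_mem hSc p)
    rw [Finset.mem_filter, Finset.mem_range] at this
    exact ⟨by have := this.1; simp only [g]; omega, this.2⟩
  have hga : ∀ p, l[2 * g p + 1]'(by have := (hg p).1; omega) ∈ C a := by
    intro p
    have h2 := (hg p).2
    simp only [f, dif_pos (hg p).1, Prod.mk.injEq] at h2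
    have h3 := hcl (l[2 * g p + 1]'(by have := (hg p).1; omega))
    rwa [h2.1] at h3
  have hgb : ∀ p, l[2 * g p + 2]'(hg p).1 ∈ C b := by
    intro p
    have h2 := (hg p).2
    simp only [f, dif_pos (hg p).1, Prod.mk.injEq] at h2
    have h3 := hcl (l[2 * g p + 2]'(by have := (hg p).1; omega))
    rwa [h2.2] at h3
  let h : Fin (2 * (z + 1)) → ℕ := fun q =>
    2 * g ⟨(q + 1) / 2, by have := q.2; omega⟩ + (2 - q % 2)
  have hlt : ∀ q, h q < l.length := by
    intro q
    have := (hg ⟨(q + 1) / 2, by have := q.2; omega⟩).1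
    simp only [h]
    omega
  have hmono : StrictMono h := by
    intro p q hpq
    have hpq' : (p : ℕ) < q := hpq
    simp only [h]
    rcases Nat.lt_or_ge (((p : ℕ) + 1) / 2) (((q : ℕ) + 1) / 2) with hlt' | hge
    · have := g.strictMono (show (⟨((p : ℕ) + 1) / 2, by have := p.2; omega⟩ : Fin (z + 2))
        < ⟨((q : ℕ) + 1) / 2, by have := q.2; omega⟩ from hlt')
      omega
    · have he : ((p : ℕ) + 1) / 2 = ((q : ℕ) + 1) / 2 := by omega
      simp only [he]
      omega
  have halt' : HasAlt (L i) (B ∩ C b) ((linkSupport L \ B) ∩ C a) (z + 1) := by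
    refine ⟨_, (ofFn_sublist l _ h hmono hlt).trans hl, List.length_ofFn, ?_⟩
    intro q hq
    have hq' : q < 2 * (z + 1) := by rwa [List.length_ofFn] at hq
    simp only [List.get_eq_getElem, List.getElem_ofFn]
    split_ifs with hpar
    · have he : h ⟨q, hq'⟩ = 2 * g ⟨(q + 1) / 2, by omega⟩ + 2 := by simp only [h]; omega
      simp only [he]
      exact ⟨hB _ _, hgb _⟩
    · have he : h ⟨q, hq'⟩ = 2 * g ⟨(q + 1) / 2, by omega⟩ + 1 := by simp only [h]; omega
      simp only [he]
      exact ⟨hA _ _, hga _⟩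
  have h1 := le_csSup (hasAlt_bddAbove _ _ _) halt'
  have h2 := hwig a b hab' i
  unfold wiggle at h2
  omega
end
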